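/- If Q is a prismatoid of dimension d with n vertices and width l > d, then there exists a prismatoid Q' of dimension n − d with 2n − 2d vertices and width at least l + n − 2d; in particular Q' violates the dual Hirsch conjecture. -/

import Mathlib

noncomputable section

/-- `d`-dimensional Euclidean space. -/
abbrev Esp (d : ℕ) := EuclideanSpace ℝ (Fin d)

/-- The (affine) dimension of a subset of Euclidean space. -/
def polyDim {d : ℕ} (S : Set (Esp d)) : ℕ := Module.finrank ℝ (affineSpan ℝ S).direction

/-- A polytope is a convex hull of finitely many points. -/
def IsPolytope {d : ℕ} (P : Set (Esp d)) : Prop := ∃ S : Finset (Esp d), P = convexHull ℝ ↑S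

/-- A facet of a polytope `P`: a proper nonempty exposed face of dimension one
less than `P`. -/
def IsFacet {d : ℕ} (P F : Set (Esp d)) : Prop :=
  IsExposed ℝ P F ∧ F ≠ P ∧ F.Nonempty ∧ polyDim F + 1 = polyDim P

/-- The dual graph of a polytope: vertices are the facets, two facets being
adjacent when their intersection is a ridge (a face of codimension 2). -/
def dualGraph {d : ℕ} (P : Set (Esp d)) : SimpleGraph {F : Set (Esp d) // IsFacet P F} :=
  SimpleGraph.fromRel (fun F G => polyDim ((F : Set (Esp d)) ∩ (G : Set (Esp d))) + 2 = polyDim P)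

/-- A `d`-prismatoid: a `d`-dimensional polytope with two distinct parallel
facets `Qp`, `Qm` (the bases) containing all of its vertices (extreme points). -/
structure Prismatoid (d : ℕ) where
  P : Set (Esp d)
  Qp : Set (Esp d)
  Qm : Set (Esp d)
  poly : IsPolytope P
  dimP : polyDim P = d
  facetP : IsFacet P Qp
  facetM : IsFacet P Qm
  ne : Qp ≠ Qm
  parallel : (affineSpan ℝ Qp).direction = (affineSpan ℝ Qm).direction
  cover : Set.extremePoints ℝ P ⊆ Qp ∪ Qm

/-- Number of vertices of a prismatoid. -/
def Prismatoid.nverts {d : ℕ} (Q : Prismatoid d) : ℕ := (Set.extremePoints ℝ Q.P).ncard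

/-- The width of a prismatoid: the distance between the two bases in the dual
graph of the polytope. -/
def Prismatoid.width {d : ℕ} (Q : Prismatoid d) : ℕ :=
  (dualGraph Q.P).dist ⟨Q.Qp, Q.facetP⟩ ⟨Q.Qm, Q.facetM⟩

namespace VectorConfig

open Module Filter Topology

variable {E ι : Type*} [AddCommGroup E] [Module ℝ E]

/-- The linear rank of the vectors of the configuration `p` indexed by `T`. -/
def rk (p : ι → E) (T : Set ι) : ℕ := finrank ℝ (Submodule.span ℝ (p '' T))

/-- `F` is the vanishing set of a nonzero functional that is nonnegative on `p`, and its vectors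
span a hyperplane. These are the facets of the cone over `p`. -/
def IsFac (p : ι → E) (F : Set ι) : Prop :=
  (∃ f : Dual ℝ E, f ≠ 0 ∧ (∀ i, 0 ≤ f (p i)) ∧ ∀ i, i ∈ F ↔ f (p i) = 0) ∧
    finrank ℝ E ≤ rk p F + 1

/-- The dual graph of the cone over a vector configuration. -/
def facGraph (p : ι → E) : SimpleGraph {F : Set ι // IsFac p F} where
  Adj F G := F ≠ G ∧ finrank ℝ E ≤ rk p (F.1 ∩ G.1) + 2
  symm := ⟨fun F G h => ⟨h.1.symm, by rw [Set.inter_comm]; exact h.2⟩⟩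
  loopless := ⟨fun _ h => h.1 rfl⟩

variable {p : ι → E}

lemma apply_eq_zero_of_mem_span {f : Dual ℝ E} {T : Set ι} (h : ∀ i ∈ T, f (p i) = 0) {x : E}
    (hx : x ∈ Submodule.span ℝ (p '' T)) : f x = 0 := by
  have : Submodule.span ℝ (p '' T) ≤ LinearMap.ker f := by
    rw [Submodule.span_le]
    rintro _ ⟨i, hi, rfl⟩
    exact h i hi
  exact this hx

lemma exists_apply_ne_zero {f : Dual ℝ E} (hf : f ≠ 0) : ∃ x, f x ≠ 0 := by
  by_contra! h
  exact hf (LinearMap.ext h)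

lemma span_image_insert (u : ι) (T : Set ι) :
    Submodule.span ℝ (p '' insert u T) =
      Submodule.span ℝ (p '' T) ⊔ Submodule.span ℝ {p u} := by
  rw [Set.image_insert_eq, Submodule.span_insert, sup_comm]

lemma rk_congr {p' : ι → E} {T : Set ι} (h : ∀ i ∈ T, p i = p' i) : rk p T = rk p' T := by
  rw [rk, rk, Set.image_congr h]

open Classical in
/-- The one-point suspension over `v ∈ B`, with the vertex `u ∈ A` then pushed off by height `ε`,
so that both bases gain a dimension. The apexes are `some v` and `none`. -/
def lift {X : Type*} (p : ι → X) (u v : ι) (ε : ℝ) : Option ι → X × ℝ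
  | none => (p v, -1)
  | some i => (p i, if i = v then 1 else if i = u then ε else 0)

section Lift

variable {X : Type*} {p : ι → X} {u v : ι} {ε : ℝ}

lemma lift_none : lift p u v ε none = (p v, -1) := rfl

lemma lift_apex : lift p u v ε (some v) = (p v, 1) := by simp [lift]

lemma lift_raised (huv : u ≠ v) : lift p u v ε (some u) = (p u, ε) := by simp [lift, huv]

lemma lift_of_ne {i : ι} (hu : i ≠ u) (hv : i ≠ v) : lift p u v ε (some i) = (p i, 0) := by
  simp [lift, hu, hv]

lemma fst_lift_none : (lift p u v ε none).1 = p v := rfl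

lemma fst_lift_some (i : ι) : (lift p u v ε (some i)).1 = p i := rfl

end Lift

lemma apply_prod (f : Dual ℝ (E × ℝ)) (x : E) (t : ℝ) : f (x, t) = f (x, 0) + t * f (0, 1) := by
  have : ((x, t) : E × ℝ) = (x, 0) + t • (0, 1) := by simp
  rw [this, map_add, map_smul, smul_eq_mul]

/-- The trace on the original index set of a set of vectors of the suspension. -/
def trace (v : ι) (T : Set (Option ι)) : Set ι := {i | some i ∈ T ∧ (i = v → none ∈ T)}

lemma image_fst_lift_subset {u v : ι} {ε : ℝ} {T : Set (Option ι)} {S : Set ι}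
    (hS : ∀ i, some i ∈ T → i ∈ S)
    (hn : none ∈ T → v ∈ S) :
    (Submodule.span ℝ (lift p u v ε '' T)).map (LinearMap.fst ℝ E ℝ) ≤
      Submodule.span ℝ (p '' S) := by
  rw [Submodule.map_span, Submodule.span_le]
  rintro _ ⟨_, ⟨o, ho, rfl⟩, rfl⟩
  cases o with
  | none => exact Submodule.subset_span ⟨v, hn ho, rfl⟩
  | some i => exact Submodule.subset_span ⟨i, hS i ho, rfl⟩

section Lift

variable {u v : ι} {ε : ℝ}

lemma apex_mem_iff_or {F : Set (Option ι)} (hF : IsFac (lift p u v ε) F) :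
    (some v ∈ F ↔ none ∈ F) ∨
      ∃ f : Dual ℝ (E × ℝ), f (0, 1) ≠ 0 ∧ ∀ o ∈ F, f (lift p u v ε o) = 0 := by
  obtain ⟨⟨f, -, -, hfF⟩, -⟩ := hF
  by_cases hc : f (0, 1) = 0
  · left
    rw [hfF, hfF, lift_apex, lift_none, apply_prod f _ 1, apply_prod f _ (-1), hc]
    simp
  · exact Or.inr ⟨f, hc, fun o ho => (hfF o).1 ho⟩

lemma apex_mem_inter_iff_or {F G : Set (Option ι)} (hF : IsFac (lift p u v ε) F)
    (hG : IsFac (lift p u v ε) G) :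
    (some v ∈ F ∩ G ↔ none ∈ F ∩ G) ∨
      ∃ f : Dual ℝ (E × ℝ), f (0, 1) ≠ 0 ∧ ∀ o ∈ F ∩ G, f (lift p u v ε o) = 0 := by
  rcases apex_mem_iff_or hF with h | ⟨f, hf, hfF⟩
  · rcases apex_mem_iff_or hG with h' | ⟨f, hf, hfG⟩
    · exact Or.inl (and_congr h h')
    · exact Or.inr ⟨f, hf, fun o ho => hfG o ho.2⟩
  · exact Or.inr ⟨f, hf, fun o ho => hfF o ho.1⟩

lemma exists_supported_trace (huv : u ≠ v) {F : Set (Option ι)} {f : Dual ℝ (E × ℝ)} (hf : f ≠ 0)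
    (hf0 : ∀ o, 0 ≤ f (lift p u v 0 o)) (hfF : ∀ o ∈ F, f (lift p u v 0 o) = 0) :
    ∃ g : Dual ℝ E, g ≠ 0 ∧ (∀ i, 0 ≤ g (p i)) ∧ ∀ i ∈ trace v F, g (p i) = 0 := by
  have hl {i : ι} (hi : i ≠ v) : lift p u v 0 (some i) = (p i, 0) := by
    rcases eq_or_ne i u with rfl | hu
    · exact lift_raised huv
    · exact lift_of_ne hu hi
  refine ⟨f ∘ₗ LinearMap.inl ℝ E ℝ, fun h => hf ?_, fun i => ?_, fun i hi => ?_⟩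
  · have h0 (x : E) : f (x, 0) = 0 := LinearMap.congr_fun h x
    have h1 := hf0 (some v)
    have h2 := hf0 none
    rw [lift_apex, apply_prod, h0] at h1
    rw [lift_none, apply_prod, h0] at h2
    have hc : f (0, 1) = 0 := by linarith
    ext x <;> simp [h0, hc]
  · change 0 ≤ f (p i, 0)
    rcases eq_or_ne i v with rfl | hi
    · have h1 := hf0 (some i)
      have h2 := hf0 none
      rw [lift_apex, apply_prod] at h1
      rw [lift_none, apply_prod] at h2
      linarith
    · exact hl hi ▸ hf0 (some i)
  · change f (p i, 0) = 0
    rcases eq_or_ne i v with rfl | hiv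
    · have h1 := hfF _ hi.1
      have h2 := hfF _ (hi.2 rfl)
      rw [lift_apex, apply_prod] at h1
      rw [lift_none, apply_prod] at h2
      linarith
    · exact hl hiv ▸ hfF _ hi.1

lemma trace_inter (F G : Set (Option ι)) : trace v (F ∩ G) = trace v F ∩ trace v G := by
  ext i
  simp only [trace, Set.mem_inter_iff, Set.mem_ofPred_eq]
  tauto

end Lift

lemma rk_le_ncard [Finite ι] (T : Set ι) : rk p T ≤ T.ncard := by
  classical
  have := Fintype.ofFinite ι
  have h := finrank_span_le_card (R := ℝ) (p '' T)
  rw [← Set.ncard_eq_toFinset_card'] at h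
  exact h.trans (Set.ncard_image_le T.toFinite)

lemma linearIndepOn_of_ncard_le [Finite ι] {A : Set ι} (h : A.ncard ≤ rk p A) :
    LinearIndepOn ℝ p A := by
  have := Fintype.ofFinite A
  refine linearIndependent_iff_card_eq_finrank_span.2 ?_
  rw [← Set.image_eq_range, ← Nat.card_eq_fintype_card, Nat.card_coe_set_eq]
  exact h.antisymm (rk_le_ncard A)

lemma exists_mem_span_diff [Finite ι] {A : Set ι} (h : rk p A < A.ncard) :
    ∃ u ∈ A, p u ∈ Submodule.span ℝ (p '' (A \ {u})) := by
  by_contra! hcon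
  have hli : LinearIndepOn ℝ p A := linearIndepOn_iff_notMem_span.2 hcon
  have := Fintype.ofFinite A
  have h1 := finrank_span_eq_card hli
  rw [← Set.image_eq_range, ← Nat.card_eq_fintype_card, Nat.card_coe_set_eq] at h1
  exact h.ne h1

lemma rk_empty : rk p ∅ = 0 := by
  rw [rk, Set.image_empty, Submodule.span_empty, finrank_bot]

/-- Each vector of a simplicial facet spans an extreme ray of the cone. -/
lemma exists_apply_eq_zero_iff [Finite ι] {A : Set ι} (hA : IsFac p A) (hli : LinearIndepOn ℝ p A)
    {i : ι} (hi : i ∈ A) :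
    ∃ f : Dual ℝ E, (∀ j, 0 ≤ f (p j)) ∧ ∀ j, j ∈ ({i} : Set ι) ↔ f (p j) = 0 := by
  classical
  obtain ⟨⟨f, -, hf0, hfA⟩, -⟩ := hA
  replace hli : LinearIndependent ℝ fun j : A => p j := hli
  obtain ⟨g, hg⟩ := LinearMap.exists_extend
    ((Basis.span hli).constr ℝ fun j : A => if j.1 = i then (0 : ℝ) else 1)
  have hgA (j : ι) (hj : j ∈ A) : g (p j) = if j = i then 0 else 1 := by
    have h1 := (Basis.span hli).constr_basis ℝ (fun j : A => if j.1 = i then (0 : ℝ) else 1) ⟨j, hj⟩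
    rw [← hg] at h1
    rwa [LinearMap.comp_apply, Submodule.subtype_apply, Basis.span_apply] at h1
  obtain ⟨N, hN⟩ : ∃ N : ℝ, ∀ j, j ∉ A → 0 < g (p j) + N * f (p j) := by
    refine Eventually.exists (f := atTop) ?_
    rw [eventually_all]
    intro j
    by_cases hj : j ∈ A
    · simp [hj]
    have hfj : 0 < f (p j) := (hf0 j).lt_of_ne' (mt (hfA j).2 hj)
    filter_upwards [(tendsto_atTop_add_const_left atTop (g (p j))
      (tendsto_id.atTop_mul_const hfj)).eventually_gt_atTop 0] with N hN _ using hN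
  have key (j : ι) : (g + N • f) (p j) = g (p j) + N * f (p j) := rfl
  refine ⟨g + N • f, fun j => ?_, fun j => ?_⟩ <;> by_cases hj : j ∈ A
  · rw [key, (hfA j).1 hj, hgA j hj]
    split_ifs <;> simp
  · exact (hN j hj).le
  · rw [key, (hfA j).1 hj, hgA j hj]
    split_ifs with h <;> simp [h]
  · exact iff_of_false (fun h => hj (h ▸ hi)) (hN j hj).ne'

variable [FiniteDimensional ℝ E]

lemma rk_mono {S T : Set ι} (h : S ⊆ T) : rk p S ≤ rk p T :=
  Submodule.finrank_mono (Submodule.span_mono (Set.image_mono h))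

lemma finrank_lt_of_apply_ne_zero {f : Dual ℝ E} {x : E} (hx : f x ≠ 0) {M : Submodule ℝ E}
    (hM : ∀ y ∈ M, f y = 0) : finrank ℝ M < finrank ℝ E :=
  Submodule.finrank_lt fun h => hx (hM x (h ▸ Submodule.mem_top))

lemma rk_lt {f : Dual ℝ E} (hf : f ≠ 0) {T : Set ι} (h : ∀ i ∈ T, f (p i) = 0) :
    rk p T < finrank ℝ E := by
  obtain ⟨x, hx⟩ := exists_apply_ne_zero hf
  exact finrank_lt_of_apply_ne_zero hx fun y hy => apply_eq_zero_of_mem_span h hy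

lemma finrank_sup_singleton_le (M : Submodule ℝ E) (x : E) :
    finrank ℝ ↥(M ⊔ Submodule.span ℝ {x}) ≤ finrank ℝ M + 1 := by
  have h1 := Submodule.finrank_add_le_finrank_add_finrank M (Submodule.span ℝ {x})
  have h2 := finrank_span_le_card (R := ℝ) ({x} : Set E)
  simp at h2
  omega

lemma finrank_sup_singleton {M : Submodule ℝ E} {x : E} (hx : x ∉ M) :
    finrank ℝ ↥(M ⊔ Submodule.span ℝ {x}) = finrank ℝ M + 1 := by
  refine le_antisymm (finrank_sup_singleton_le M x) ?_
  refine Submodule.finrank_lt_finrank_of_lt (lt_of_le_of_ne le_sup_left fun h => hx ?_)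
  rw [h]
  exact Submodule.mem_sup_right (Submodule.mem_span_singleton_self x)

lemma rk_insert_le (u : ι) (T : Set ι) : rk p (insert u T) ≤ rk p T + 1 := by
  rw [rk, span_image_insert]
  exact finrank_sup_singleton_le _ _

lemma rk_insert {u : ι} {T : Set ι} (hu : p u ∉ Submodule.span ℝ (p '' T)) :
    rk p (insert u T) = rk p T + 1 := by
  rw [rk, span_image_insert]
  exact finrank_sup_singleton hu

lemma rk_le_diff_singleton (u : ι) (T : Set ι) : rk p T ≤ rk p (T \ {u}) + 1 :=
  (rk_mono (by simp)).trans (rk_insert_le u (T \ {u}))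

/-- A functional vanishing on the `T`-part of `p`, where `T` has corank at most one, vanishes
wherever another nonzero such functional does. -/
lemma apply_eq_zero_of_rk {f g : Dual ℝ E} (hf : f ≠ 0) {T : Set ι}
    (hT : finrank ℝ E ≤ rk p T + 1) (hfT : ∀ i ∈ T, f (p i) = 0) (hgT : ∀ i ∈ T, g (p i) = 0)
    {x : E} (hx : f x = 0) : g x = 0 := by
  by_contra hgx
  have hxn : x ∉ Submodule.span ℝ (p '' T) := fun h => hgx (apply_eq_zero_of_mem_span hgT h)
  have h1 := finrank_sup_singleton hxn
  obtain ⟨y, hy⟩ := exists_apply_ne_zero hf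
  have h2 : finrank ℝ ↥(Submodule.span ℝ (p '' T) ⊔ Submodule.span ℝ {x}) < finrank ℝ E := by
    refine finrank_lt_of_apply_ne_zero hy ?_
    have : Submodule.span ℝ (p '' T) ⊔ Submodule.span ℝ {x} ≤ LinearMap.ker f := by
      refine sup_le ?_ ?_
      · exact fun z hz => apply_eq_zero_of_mem_span hfT hz
      · rw [Submodule.span_singleton_le_iff_mem]; exact hx
    exact fun z hz => this hz
  rw [rk] at hT
  omega

lemma IsFac.subset_of_rk {F G T : Set ι} (hF : IsFac p F) (hG : IsFac p G) (hTF : T ⊆ F)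
    (hTG : T ⊆ G) (hT : finrank ℝ E ≤ rk p T + 1) : F ⊆ G := by
  obtain ⟨⟨f, hf, -, hfF⟩, -⟩ := hF
  obtain ⟨⟨g, -, -, hgG⟩, -⟩ := hG
  intro i hi
  rw [hgG]
  exact apply_eq_zero_of_rk hf hT (fun j hj => (hfF j).1 (hTF hj))
    (fun j hj => (hgG j).1 (hTG hj)) ((hfF i).1 hi)

lemma IsFac.eq_of_rk {F G T : Set ι} (hF : IsFac p F) (hG : IsFac p G) (hTF : T ⊆ F)
    (hTG : T ⊆ G) (hT : finrank ℝ E ≤ rk p T + 1) : F = G :=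
  (hF.subset_of_rk hG hTF hTG hT).antisymm (hG.subset_of_rk hF hTG hTF hT)

lemma IsFac.eq_of_subset {F G : Set ι} (hF : IsFac p F) (hG : IsFac p G) (h : F ⊆ G) : F = G :=
  hF.eq_of_rk hG subset_rfl h hF.2

lemma IsFac.rk_add_one {F : Set ι} (hF : IsFac p F) : rk p F + 1 = finrank ℝ E := by
  obtain ⟨⟨f, hf, -, hfF⟩, h⟩ := hF
  have := rk_lt hf fun i hi => (hfF i).1 hi
  omega

lemma exists_walk_length_le {V W : Type*} {G : SimpleGraph V} {H : SimpleGraph W} (φ : V → W)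
    (hφ : ∀ a b, G.Adj a b → φ a = φ b ∨ H.Adj (φ a) (φ b)) {a b : V} {a' b' : W}
    (ha : φ a = a') (hb : φ b = b') (w : G.Walk a b) :
    ∃ w' : H.Walk a' b', w'.length ≤ w.length := by
  subst ha hb
  induction w with
  | nil => exact ⟨.nil, le_rfl⟩
  | cons h t ih =>
    obtain ⟨w', hw'⟩ := ih
    rcases hφ _ _ h with h | h
    · rw [h]
      exact ⟨w', hw'.trans (by simp)⟩
    · exact ⟨.cons h w', by simpa using hw'⟩

/-- The sets on which some nonzero nonnegative functional vanishes do not grow under small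
perturbations of a configuration. -/
lemma eventually_supported [Finite ι] (p q : ι → E) : ∀ᶠ ε : ℝ in 𝓝 0, ∀ S : Set ι,
    (∃ f : Dual ℝ E, f ≠ 0 ∧ (∀ i, 0 ≤ f (p i + ε • q i)) ∧ ∀ i ∈ S, f (p i + ε • q i) = 0) →
    ∃ f : Dual ℝ E, f ≠ 0 ∧ (∀ i, 0 ≤ f (p i)) ∧ ∀ i ∈ S, f (p i) = 0 := by
  rw [eventually_all]
  intro S
  let e := (finBasis ℝ E).dualBasis.equivFun.symm
  let K : Set ((Fin (finrank ℝ E) → ℝ) × ℝ) :=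
    (Metric.sphere 0 1 ×ˢ Metric.closedBall 0 1) ∩
      {c | (∀ i, 0 ≤ e c.1 (p i) + c.2 * e c.1 (q i)) ∧
        ∀ i ∈ S, e c.1 (p i) + c.2 * e c.1 (q i) = 0}
  have hcont (x : E) : Continuous fun c : Fin (finrank ℝ E) → ℝ => e c x :=
    ((LinearMap.applyₗ x : Dual ℝ E →ₗ[ℝ] ℝ) ∘ₗ e.toLinearMap).continuous_of_finiteDimensional
  have hcont' (i : ι) : Continuous fun c : (Fin (finrank ℝ E) → ℝ) × ℝ =>
      e c.1 (p i) + c.2 * e c.1 (q i) :=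
    ((hcont _).comp continuous_fst).add (continuous_snd.mul ((hcont _).comp continuous_fst))
  have hK : IsCompact K := by
    refine ((isCompact_sphere _ _).prod (isCompact_closedBall _ _)).inter_right ?_
    simp only [Set.ofPred_and, Set.ofPred_forall]
    refine (isClosed_iInter fun i => isClosed_le continuous_const (hcont' i)).inter
      (isClosed_iInter fun i => isClosed_iInter fun _ => isClosed_eq (hcont' i) continuous_const)
  have hclosed : IsClosed (Prod.snd '' K) := (hK.image continuous_snd).isClosed
  by_cases h0 : (0 : ℝ) ∈ Prod.snd '' K
  · refine Eventually.of_forall fun ε _ => ?_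
    obtain ⟨⟨c, t⟩, ⟨⟨hc, -⟩, h1, h2⟩, rfl⟩ := h0
    refine ⟨e c, ?_, by simpa using h1, by simpa using h2⟩
    rintro h
    have : c = 0 := by simpa using h
    simp [this] at hc
  · filter_upwards [hclosed.isOpen_compl.mem_nhds h0, Metric.closedBall_mem_nhds (0 : ℝ) one_pos]
      with ε hε hε1
    rintro ⟨f, hf, h1, h2⟩
    refine absurd ?_ hε
    let c := e.symm f
    have hc : c ≠ 0 := by simpa [c] using hf
    have hcn : 0 < ‖c‖ := norm_pos_iff.2 hc
    have hec (x : E) : e (‖c‖⁻¹ • c) x = ‖c‖⁻¹ * f x := by simp [c]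
    have key (i : ι) : e (‖c‖⁻¹ • c) (p i) + ε * e (‖c‖⁻¹ • c) (q i) =
        ‖c‖⁻¹ * f (p i + ε • q i) := by
      rw [hec, hec, map_add, map_smul, smul_eq_mul]; ring
    refine ⟨(‖c‖⁻¹ • c, ε), ⟨⟨?_, hε1⟩, fun i => ?_, fun i hi => ?_⟩, rfl⟩
    · simp [norm_smul, hcn.ne']
    · change 0 ≤ e (‖c‖⁻¹ • c) (p i) + ε * e (‖c‖⁻¹ • c) (q i)
      rw [key]
      exact mul_nonneg (by positivity) (h1 i)
    · change e (‖c‖⁻¹ • c) (p i) + ε * e (‖c‖⁻¹ • c) (q i) = 0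
      rw [key, h2 i hi, mul_zero]

open Classical in
/-- Moving one vector `u` of the base `A` along a ray makes every proper face of `A` containing `u`
a pyramid with apex `u`, without shortening dual paths between the bases. -/
theorem exists_pull [Fintype ι] {A B : Set ι} (hAB : ∀ i, i ∈ B ↔ i ∉ A) (hA : IsFac p A)
    (hB : IsFac p B) {u : ι} (hu : u ∈ A) (hAu : finrank ℝ E ≤ rk p (A \ {u}) + 1) {l : ℕ}
    (hl : ∀ w : (facGraph p).Walk ⟨A, hA⟩ ⟨B, hB⟩, l ≤ w.length) :
    ∃ (p' : ι → E) (hA' : IsFac p' A) (hB' : IsFac p' B),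
      finrank ℝ E ≤ rk p' (A \ {u}) + 1 ∧
      (∀ f : Dual ℝ E, (∀ i, 0 ≤ f (p' i)) → (∃ i ∈ A, f (p' i) ≠ 0) →
        ∀ S ⊆ A \ {u}, (∀ i ∈ S, f (p' i) = 0) → p' u ∉ Submodule.span ℝ (p' '' S)) ∧
      ∀ w : (facGraph p').Walk ⟨A, hA'⟩ ⟨B, hB'⟩, l ≤ w.length := by
  set O : E := ∑ i with i ∈ A \ {u}, p i with hO
  let q : ι → E := fun i => if i = u then O else 0
  have hbad : ∀ᶠ s : ℝ in 𝓝[>] 0, ∀ S : Set ι, O ∉ Submodule.span ℝ (p '' S) →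
      p u + s • O ∉ Submodule.span ℝ (p '' S) := by
    rw [eventually_all]
    intro S
    by_cases hS : O ∈ Submodule.span ℝ (p '' S)
    · simp [hS]
    have hsub : {s : ℝ | p u + s • O ∈ Submodule.span ℝ (p '' S)}.Subsingleton := by
      intro s hs t ht
      by_contra hst
      have := Submodule.sub_mem (Submodule.span ℝ (p '' S)) hs ht
      rw [add_sub_add_left_eq_sub, ← sub_smul] at this
      exact hS ((Submodule.smul_mem_iff _ (sub_ne_zero.2 hst)).1 this)
    have hfin := (hsub.finite.subset (Set.sdiff_subset (t := {(0 : ℝ)}))).isClosed.compl_mem_nhds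
      (x := 0) (by simp)
    filter_upwards [mem_nhdsWithin_of_mem_nhds hfin, self_mem_nhdsWithin] with s hs hs0 _ hmem
    exact hs ⟨hmem, (ne_of_gt hs0 : s ≠ 0)⟩
  obtain ⟨s, hbad, hsupp, hs⟩ := (hbad.and (((eventually_supported p q).filter_mono
    nhdsWithin_le_nhds).and self_mem_nhdsWithin)).exists
  replace hs : 0 < s := hs
  set p' : ι → E := fun i => p i + s • q i with hp'
  have hpu : p' u = p u + s • O := by simp [p', q]
  have hpi {i : ι} (hi : i ≠ u) : p' i = p i := by simp [p', q, hi]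
  have hpi' {T : Set ι} (hT : u ∉ T) : ∀ i ∈ T, p' i = p i := fun i hi =>
    hpi fun h => hT (h ▸ hi)
  have hfO (f : Dual ℝ E) : f O = ∑ i with i ∈ A \ {u}, f (p i) := by rw [hO, map_sum]
  have hAu' : finrank ℝ E ≤ rk p' (A \ {u}) + 1 := by
    rwa [rk_congr (hpi' (by simp))]
  have hA' : IsFac p' A := by
    obtain ⟨⟨f, hf, hf0, hfA⟩, -⟩ := hA
    have h0 : f O = 0 := by
      rw [hfO]
      refine Finset.sum_eq_zero fun i hi => ?_
      rw [Finset.mem_filter] at hi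
      exact (hfA i).1 hi.2.1
    have hfp (i : ι) : f (p' i) = f (p i) := by
      simp only [p', q]; split_ifs <;> simp [h0]
    exact ⟨⟨f, hf, fun i => by rw [hfp]; exact hf0 i, fun i => by rw [hfp, hfA]⟩,
      hAu'.trans (by gcongr; exact rk_mono Set.sdiff_subset)⟩
  have hB' : IsFac p' B := by
    obtain ⟨⟨f, hf, hf0, hfB⟩, hr⟩ := hB
    have h0 : 0 ≤ f O := by
      rw [hfO]
      exact Finset.sum_nonneg fun i _ => hf0 i
    have huB : u ∉ B := by simp [hAB, hu]
    have hpos : 0 < f (p' u) := by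
      have h1 : 0 < f (p u) := lt_of_le_of_ne (hf0 u) fun h => huB ((hfB u).2 h.symm)
      rw [hpu, map_add, map_smul, smul_eq_mul]
      positivity
    refine ⟨⟨f, hf, fun i => ?_, fun i => ?_⟩, by rwa [rk_congr (hpi' huB)]⟩
    · by_cases hi : i = u
      · rw [hi]; exact hpos.le
      · rw [hpi hi]; exact hf0 i
    · by_cases hi : i = u
      · rw [hi]; exact iff_of_false huB hpos.ne'
      · rw [hpi hi]; exact hfB i
  have hfOne {f : Dual ℝ E} (hf0 : ∀ i, 0 ≤ f (p' i)) (hf : ∃ i ∈ A, f (p' i) ≠ 0) : f O ≠ 0 := by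
    intro h
    have hterm (i : ι) (hi : i ∈ A \ {u}) : f (p i) = f (p' i) := by rw [hpi hi.2]
    rw [hfO, Finset.sum_eq_zero_iff_of_nonneg] at h
    · obtain ⟨i, hi, hfi⟩ := hf
      obtain ⟨⟨g, hg, -, hgA⟩, -⟩ := hA'
      refine hfi (apply_eq_zero_of_rk hg hAu' (fun j hj => (hgA j).1 hj.1) (fun j hj => ?_)
        ((hgA i).1 hi))
      rw [← hterm j hj]
      exact h j (by simpa using hj)
    · intro i hi
      rw [hterm i (by simpa using hi)]
      exact hf0 i
  have hrk {T : Set ι} (hT : O ∉ Submodule.span ℝ (p' '' T)) : rk p' T ≤ rk p T := by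
    have h1 := finrank_sup_singleton hT
    have h2 := finrank_sup_singleton_le (Submodule.span ℝ (p '' T)) O
    have h3 : Submodule.span ℝ (p' '' T) ⊔ Submodule.span ℝ {O} ≤
        Submodule.span ℝ (p '' T) ⊔ Submodule.span ℝ {O} := by
      refine sup_le ?_ le_sup_right
      rw [Submodule.span_le]
      rintro _ ⟨i, hi, rfl⟩
      refine add_mem (Submodule.mem_sup_left (Submodule.subset_span ⟨i, hi, rfl⟩))
        (Submodule.mem_sup_right (Submodule.smul_mem _ _ ?_))
      simp only [q]
      split_ifs
      · exact Submodule.mem_span_singleton_self O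
      · exact zero_mem _
    have h4 := Submodule.finrank_mono h3
    simp only [rk]
    omega
  have hrkF {F T : Set ι} (hF : IsFac p' F) (hFA : F ≠ A) (hT : T ⊆ F) : rk p' T ≤ rk p T := by
    obtain ⟨f, -, hf0, hfF⟩ := hF.1
    refine hrk fun h => hfOne hf0 ?_
      (apply_eq_zero_of_mem_span (fun i hi => (hfF i).1 (hT hi)) h)
    by_contra! hcon
    exact hFA (hA'.eq_of_subset hF fun i hi => (hfF i).2 (hcon i hi)).symm
  have hπ (F : {F : Set ι // IsFac p' F}) : ∃ G : {F : Set ι // IsFac p F}, F.1 ⊆ G.1 := by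
    obtain ⟨F, hF⟩ := F
    by_cases hFA : F = A
    · exact ⟨⟨A, hA⟩, hFA.le⟩
    · obtain ⟨f, hf, hf0, hfF⟩ := hF.1
      obtain ⟨g, hg, hg0, hgF⟩ := hsupp F ⟨f, hf, hf0, fun i hi => (hfF i).1 hi⟩
      have h1 := hrkF hF hFA subset_rfl
      have h2 : rk p F ≤ rk p {i | g (p i) = 0} := rk_mono hgF
      have h3 := hF.2
      exact ⟨⟨{i | g (p i) = 0}, ⟨g, hg, hg0, fun i => Iff.rfl⟩, by omega⟩, hgF⟩
  choose π hπ using hπ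
  refine ⟨p', hA', hB', hAu', fun f hf0 hf S hS hfS => ?_, fun w => ?_⟩
  · have huS : u ∉ S := fun h => (hS h).2 rfl
    have hOS : O ∉ Submodule.span ℝ (p' '' S) := fun h =>
      hfOne hf0 hf (apply_eq_zero_of_mem_span hfS h)
    rw [hpu, Set.image_congr (hpi' huS)]
    rw [Set.image_congr (hpi' huS)] at hOS
    exact hbad S hOS
  · have h1 : π ⟨A, hA'⟩ = ⟨A, hA⟩ := Subtype.ext (hA.eq_of_subset (π _).2 (hπ ⟨A, hA'⟩)).symm
    have h2 : π ⟨B, hB'⟩ = ⟨B, hB⟩ := Subtype.ext (hB.eq_of_subset (π _).2 (hπ ⟨B, hB'⟩)).symm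
    obtain ⟨w', hw'⟩ := exists_walk_length_le (H := facGraph p) π (fun F G hFG => by
      by_cases h : π F = π G
      · exact Or.inl h
      refine Or.inr ⟨h, hFG.2.trans ?_⟩
      have h1 : rk p (F.1 ∩ G.1) ≤ rk p ((π F).1 ∩ (π G).1) :=
        rk_mono (Set.inter_subset_inter (hπ F) (hπ G))
      have h2 : rk p' (F.1 ∩ G.1) ≤ rk p (F.1 ∩ G.1) := by
        by_cases hF : F.1 = A
        · refine hrkF G.2 (fun hG => hFG.1 (Subtype.ext (hF.trans hG.symm))) Set.inter_subset_right
        · exact hrkF F.2 hF Set.inter_subset_left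
      omega) h1 h2 w
    exact (hl w').trans hw'

lemma finrank_add_one_le_of_prod {W : Submodule ℝ E} {M : Submodule ℝ (E × ℝ)}
    (hW : ∀ x ∈ W, ((x, 0) : E × ℝ) ∈ M) (h1 : ((0, 1) : E × ℝ) ∈ M) :
    finrank ℝ W + 1 ≤ finrank ℝ M := by
  have hmem (x : W × ℝ) : (W.subtype.prodMap (LinearMap.id : ℝ →ₗ[ℝ] ℝ)) x ∈ M := by
    have := add_mem (hW x.1 x.1.2) (M.smul_mem x.2 h1)
    simpa using this
  have h := LinearMap.finrank_le_finrank_of_injective (f := LinearMap.codRestrict M _ hmem) (by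
    rw [LinearMap.injective_codRestrict_iff]
    exact W.injective_subtype.prodMap Function.injective_id)
  simpa using h

lemma finrank_le_map_fst {M : Submodule ℝ (E × ℝ)} {f : Dual ℝ (E × ℝ)} (hf : f (0, 1) ≠ 0)
    (hM : ∀ m ∈ M, f m = 0) : finrank ℝ M ≤ finrank ℝ (M.map (LinearMap.fst ℝ E ℝ)) := by
  refine LinearMap.finrank_le_finrank_of_injective
    (f := (LinearMap.fst ℝ E ℝ).submoduleMap M) ?_
  rw [injective_iff_map_eq_zero]
  rintro ⟨⟨x, t⟩, hm⟩ h
  have hx : x = 0 := congrArg Subtype.val h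
  have h0 := hM _ hm
  have : ((x, t) : E × ℝ) = t • (0, 1) := by simp [hx]
  rw [this, map_smul, smul_eq_mul] at h0
  simp [hx, (mul_eq_zero.1 h0).resolve_right hf]

lemma finrank_le_map_fst_add_one (M : Submodule ℝ (E × ℝ)) :
    finrank ℝ M ≤ finrank ℝ (M.map (LinearMap.fst ℝ E ℝ)) + 1 := by
  have h := LinearMap.finrank_le_finrank_of_injective
    (f := ((LinearMap.fst ℝ E ℝ).submoduleMap M).prod (LinearMap.snd ℝ E ℝ ∘ₗ M.subtype)) (by
      rw [injective_iff_map_eq_zero]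
      rintro ⟨⟨x, t⟩, hm⟩ h
      have hx : x = 0 := congrArg (fun z => z.1.1) h
      have ht : t = 0 := congrArg (fun z => z.2) h
      simp [hx, ht])
  simpa using h

section Lift

variable {u v : ι} {ε : ℝ}

lemma rk_lift_le_of_apply {T : Set (Option ι)} {S : Set ι} (hS : ∀ i, some i ∈ T → i ∈ S)
    (hn : none ∈ T → v ∈ S) {f : Dual ℝ (E × ℝ)} (hf : f (0, 1) ≠ 0)
    (hfT : ∀ o ∈ T, f (lift p u v ε o) = 0) : rk (lift p u v ε) T ≤ rk p S :=
  (finrank_le_map_fst hf fun _ hm => apply_eq_zero_of_mem_span hfT hm).trans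
    (Submodule.finrank_mono (image_fst_lift_subset hS hn))

lemma rk_lift_le_trace {T : Set (Option ι)} (hT : (some v ∈ T ↔ none ∈ T) ∨
    ∃ f : Dual ℝ (E × ℝ), f (0, 1) ≠ 0 ∧ ∀ o ∈ T, f (lift p u v ε o) = 0) :
    rk (lift p u v ε) T ≤ rk p (trace v T) + 1 := by
  by_cases h : some v ∈ T ↔ none ∈ T
  · refine (finrank_le_map_fst_add_one _).trans ?_
    gcongr
    exact Submodule.finrank_mono (image_fst_lift_subset
      (fun i hi => ⟨hi, fun hiv => h.1 (hiv ▸ hi)⟩) fun hn => ⟨h.2 hn, fun _ => hn⟩)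
  · obtain ⟨f, hf, hfT⟩ := hT.resolve_left h
    obtain ⟨x, hx⟩ : ∃ x, ∀ o ∈ T, (o = none ∨ o = some v) → o = x := by
      by_cases hn : none ∈ T
      · exact ⟨none, by grind⟩
      · exact ⟨some v, by grind⟩
    refine (rk_le_diff_singleton x T).trans ?_
    gcongr
    refine rk_lift_le_of_apply (fun i hi => ⟨hi.1, ?_⟩) (fun hn => ?_) hf fun o ho => hfT o ho.1
    · rintro rfl
      exact absurd (hx _ hi.1 (Or.inr rfl)) hi.2
    · exact absurd (hx _ hn.1 (Or.inl rfl)) hn.2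

lemma isFac_lift_raised {A B : Set ι} (hAB : ∀ i, i ∈ B ↔ i ∉ A) (hA : IsFac p A) (hu : u ∈ A)
    (hv : v ∈ B) (hAu : finrank ℝ E ≤ rk p (A \ {u}) + 1) (hε : ε ≠ 0) :
    IsFac (lift p u v ε) (some '' A) := by
  obtain ⟨⟨f, hf, hf0, hfA⟩, -⟩ := hA
  have huv : u ≠ v := fun h => (hAB v).1 hv (h ▸ hu)
  refine ⟨⟨f ∘ₗ LinearMap.fst ℝ E ℝ, ?_, ?_, ?_⟩, ?_⟩
  · obtain ⟨x, hx⟩ := exists_apply_ne_zero hf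
    exact fun h => hx (by simpa using LinearMap.congr_fun h (x, 0))
  · rintro (_ | i)
    exacts [hf0 v, hf0 i]
  · rintro (_ | i)
    · simpa [fst_lift_none] using fun h => (hAB v).1 hv ((hfA v).2 h)
    · simpa [fst_lift_some] using hfA i
  · have hmem {o : Option ι} (ho : o ∈ some '' A) :
        lift p u v ε o ∈ Submodule.span ℝ (lift p u v ε '' (some '' A)) :=
      Submodule.subset_span ⟨o, ho, rfl⟩
    have hW : ∀ x ∈ Submodule.span ℝ (p '' (A \ {u})),
        ((x, 0) : E × ℝ) ∈ Submodule.span ℝ (lift p u v ε '' (some '' A)) := by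
      suffices Submodule.span ℝ (p '' (A \ {u})) ≤
          (Submodule.span ℝ (lift p u v ε '' (some '' A))).comap (LinearMap.inl ℝ E ℝ) from
        fun x hx => this hx
      rw [Submodule.span_le]
      rintro _ ⟨i, hi, rfl⟩
      have hiv : i ≠ v := fun h => (hAB v).1 hv (h ▸ hi.1)
      have := hmem (Set.mem_image_of_mem some hi.1)
      rwa [lift_of_ne hi.2 hiv] at this
    have hpu : p u ∈ Submodule.span ℝ (p '' (A \ {u})) := by
      by_contra hcon
      have h1 := rk_insert hcon
      have h2 := rk_lt (T := insert u (A \ {u})) hf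
        (by simpa using ⟨(hfA u).1 hu, fun i hi => (hfA i).1 hi⟩)
      omega
    have h1 : ((0, 1) : E × ℝ) ∈ Submodule.span ℝ (lift p u v ε '' (some '' A)) := by
      have := Submodule.smul_mem _ ε⁻¹
        (sub_mem (hmem (Set.mem_image_of_mem some hu)) (hW _ hpu))
      rw [lift_raised huv] at this
      simpa [hε] using this
    have := finrank_add_one_le_of_prod hW h1
    simp only [rk, finrank_prod, finrank_self] at *
    omega

lemma isFac_lift_suspended {A B : Set ι} (hAB : ∀ i, i ∈ B ↔ i ∉ A) (hB : IsFac p B)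
    (hu : u ∈ A) (hv : v ∈ B) : IsFac (lift p u v ε) (insert none (some '' B)) := by
  obtain ⟨⟨f, hf, hf0, hfB⟩, hr⟩ := hB
  refine ⟨⟨f ∘ₗ LinearMap.fst ℝ E ℝ, ?_, ?_, ?_⟩, ?_⟩
  · obtain ⟨x, hx⟩ := exists_apply_ne_zero hf
    exact fun h => hx (by simpa using LinearMap.congr_fun h (x, 0))
  · rintro (_ | i)
    exacts [hf0 v, hf0 i]
  · rintro (_ | i)
    · simpa [fst_lift_none] using (hfB v).1 hv
    · simpa [fst_lift_some] using hfB i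
  · have hmem {o : Option ι} (ho : o ∈ insert none (some '' B)) :
        lift p u v ε o ∈ Submodule.span ℝ (lift p u v ε '' (insert none (some '' B))) :=
      Submodule.subset_span ⟨o, ho, rfl⟩
    have hm1 := hmem (Set.mem_insert_of_mem _ (Set.mem_image_of_mem some hv))
    have hm2 := hmem (Set.mem_insert none _)
    rw [lift_apex] at hm1
    rw [lift_none] at hm2
    have hpv := Submodule.smul_mem _ (2⁻¹ : ℝ) (add_mem hm1 hm2)
    have h1 := Submodule.smul_mem _ (2⁻¹ : ℝ) (sub_mem hm1 hm2)
    have hW : ∀ x ∈ Submodule.span ℝ (p '' B),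
        ((x, 0) : E × ℝ) ∈ Submodule.span ℝ (lift p u v ε '' (insert none (some '' B))) := by
      suffices Submodule.span ℝ (p '' B) ≤
          (Submodule.span ℝ (lift p u v ε '' (insert none (some '' B)))).comap
            (LinearMap.inl ℝ E ℝ) from fun x hx => this hx
      rw [Submodule.span_le]
      rintro _ ⟨i, hi, rfl⟩
      change ((p i, 0) : E × ℝ) ∈ Submodule.span ℝ (lift p u v ε '' insert none (some '' B))
      by_cases hiv : i = v
      · rw [hiv]
        convert! hpv using 1
        ext <;> simp [← two_smul ℝ (p v), smul_smul]
      · have hiu : i ≠ u := fun h => (hAB i).1 hi (h ▸ hu)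
        have := hmem (Set.mem_insert_of_mem _ (Set.mem_image_of_mem some hi))
        rwa [lift_of_ne hiu hiv] at this
    have := finrank_add_one_le_of_prod hW (by
      convert! h1 using 1
      ext <;> simp; norm_num)
    simp only [rk, finrank_prod, finrank_self] at *
    omega

/-- A facet of the suspension adjacent to the raised base `A` has its trace inside the facet `A`
of the original configuration, provided that the faces of `A` through `u` are pyramids. -/
lemma finrank_le_of_raised {A B : Set ι} (hAB : ∀ i, i ∈ B ↔ i ∉ A) (hu : u ∈ A) (hv : v ∈ B)
    (hpull : ∀ f : Dual ℝ E, (∀ i, 0 ≤ f (p i)) → (∃ i ∈ A, f (p i) ≠ 0) →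
        ∀ S ⊆ A \ {u}, (∀ i ∈ S, f (p i) = 0) → p u ∉ Submodule.span ℝ (p '' S))
    (hA' : IsFac (lift p u v ε) (some '' A)) {F : Set (Option ι)} (hF : IsFac (lift p u v ε) F)
    (hne : some '' A ≠ F)
    (hadj : finrank ℝ (E × ℝ) ≤ rk (lift p u v ε) (some '' A ∩ F) + 2) :
    finrank ℝ E ≤ rk p (A ∩ trace v F) + 1 := by
  have huv : u ≠ v := fun h => (hAB v).1 hv (h ▸ hu)
  have hvA : v ∉ A := (hAB v).1 hv
  have hS {i : ι} (hi : some i ∈ some '' A ∩ F) : i ∈ A ∩ trace v F := by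
    obtain ⟨⟨j, hj, hij⟩, hiF⟩ := hi
    obtain rfl := Option.some_injective _ hij
    exact ⟨hj, hiF, fun h => absurd (h ▸ hj) hvA⟩
  suffices rk (lift p u v ε) (some '' A ∩ F) ≤ rk p (A ∩ trace v F) by
    simp only [finrank_prod, finrank_self] at hadj
    omega
  obtain ⟨⟨f, hf, hf0, hfF⟩, -⟩ := id hF
  by_cases hc : f (0, 1) = 0
  · have hfp (o : Option ι) (x : E) (t : ℝ) (h : lift p u v ε o = (x, t)) :
        f (lift p u v ε o) = f (x, 0) := by rw [h, apply_prod, hc, mul_zero, add_zero]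
    by_cases huF : some u ∈ F
    · have h1 : some '' A ∩ F ⊆ insert (some u) ((some '' A ∩ F) \ {some u}) := by simp
      have h2 : rk (lift p u v ε) ((some '' A ∩ F) \ {some u}) ≤ rk p ((A ∩ trace v F) \ {u}) := by
        refine rk_lift_le_of_apply (f := LinearMap.snd ℝ E ℝ) (fun i hi => ⟨hS hi.1, ?_⟩) ?_ ?_ ?_
        · rintro rfl
          exact hi.2 rfl
        · simp
        · simp
        · rintro _ ⟨⟨⟨i, hi, rfl⟩, -⟩, hiu⟩
          rw [lift_of_ne (fun h : i = u => hiu (h ▸ rfl)) (fun h : i = v => hvA (h ▸ hi))]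
          rfl
      have h3 := rk_insert (hpull (f ∘ₗ LinearMap.inl ℝ E ℝ) (fun i => ?_) ?_
        ((A ∩ trace v F) \ {u}) (Set.sdiff_subset_sdiff_left Set.inter_subset_left) ?_)
      · have h4 : insert u ((A ∩ trace v F) \ {u}) ⊆ A ∩ trace v F := by
          rw [Set.insert_sdiff_singleton]
          exact Set.insert_subset ⟨hu, huF, fun h => absurd h huv⟩ subset_rfl
        have h5 := rk_mono (p := p) h4
        have h6 := rk_le_diff_singleton (p := lift p u v ε) (some u) (some '' A ∩ F)
        omega
      · exact hfp (some i) _ _ rfl ▸ hf0 _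
      · by_contra! hcon
        refine hne (hA'.eq_of_subset hF ?_)
        rintro _ ⟨i, hi, rfl⟩
        rw [hfF, hfp (some i) _ _ rfl]
        exact hcon i hi
      · rintro i ⟨⟨-, hi, -⟩, -⟩
        exact (hfp (some i) _ _ rfl).symm.trans ((hfF _).1 hi)
    · refine rk_lift_le_of_apply (f := LinearMap.snd ℝ E ℝ) (fun i hi => hS hi) ?_ ?_ ?_
      · simp
      · simp
      · rintro _ ⟨⟨i, hi, rfl⟩, hiF⟩
        rw [lift_of_ne (fun h : i = u => huF (h ▸ hiF)) (fun h : i = v => hvA (h ▸ hi))]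
        rfl
  · exact rk_lift_le_of_apply (fun i hi => hS hi) (by simp) hc fun o ho => (hfF o).1 ho.2

/-- Suspending over `v ∈ B` and raising `u ∈ A` increases the distance between the bases. -/
theorem exists_lift [Finite ι] {A B : Set ι} (hAB : ∀ i, i ∈ B ↔ i ∉ A) (hA : IsFac p A)
    (hB : IsFac p B) (hu : u ∈ A) (hv : v ∈ B) (hAu : finrank ℝ E ≤ rk p (A \ {u}) + 1)
    (hpull : ∀ f : Dual ℝ E, (∀ i, 0 ≤ f (p i)) → (∃ i ∈ A, f (p i) ≠ 0) →
        ∀ S ⊆ A \ {u}, (∀ i ∈ S, f (p i) = 0) → p u ∉ Submodule.span ℝ (p '' S))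
    {l : ℕ} (hl : ∀ w : (facGraph p).Walk ⟨A, hA⟩ ⟨B, hB⟩, l ≤ w.length) :
    ∃ (ε : ℝ) (hA' : IsFac (lift p u v ε) (some '' A))
      (hB' : IsFac (lift p u v ε) (insert none (some '' B))),
      ∀ w : (facGraph (lift p u v ε)).Walk ⟨_, hA'⟩ ⟨_, hB'⟩, l + 1 ≤ w.length := by
  classical
  have huv : u ≠ v := fun h => (hAB v).1 hv (h ▸ hu)
  obtain ⟨ε, hsupp, hε⟩ := (((eventually_supported (lift p u v 0)
    (fun o => if o = some u then ((0, 1) : E × ℝ) else 0)).filter_mono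
      (nhdsWithin_le_nhds (s := {0}ᶜ))).and self_mem_nhdsWithin).exists
  replace hε : ε ≠ 0 := hε
  have hlift (o : Option ι) :
      lift p u v 0 o + ε • (if o = some u then ((0, 1) : E × ℝ) else 0) = lift p u v ε o := by
    by_cases ho : o = some u
    · simp [ho, lift_raised huv]
    · rcases o with _ | i
      · simp [lift_none]
      · simp only [Option.some.injEq] at ho
        simp [lift, ho]
  simp only [hlift] at hsupp
  have hA' := isFac_lift_raised (ε := ε) hAB hA hu hv hAu hε
  have hB' := isFac_lift_suspended (ε := ε) hAB hB hu hv
  have hex (F : {F // IsFac (lift p u v ε) F}) :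
      ∃ G : {G // IsFac p G}, trace v F.1 ⊆ G.1 := by
    obtain ⟨⟨f, hf, hf0, hfF⟩, hr⟩ := F.2
    obtain ⟨f', hf', hf0', hfF'⟩ := hsupp F.1 ⟨f, hf, hf0, fun o ho => (hfF o).1 ho⟩
    obtain ⟨g, hg, hg0, hgF⟩ := exists_supported_trace huv hf' hf0' hfF'
    have := rk_lift_le_trace (apex_mem_iff_or F.2)
    have h2 : rk p (trace v F.1) ≤ rk p {i | g (p i) = 0} := rk_mono hgF
    simp only [finrank_prod, finrank_self] at hr
    exact ⟨⟨{i | g (p i) = 0}, ⟨g, hg, hg0, fun i => Iff.rfl⟩, by omega⟩, hgF⟩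
  choose π hπ using hex
  have hπB : π ⟨_, hB'⟩ = ⟨B, hB⟩ := by
    refine Subtype.ext (hB.eq_of_subset (π ⟨_, hB'⟩).2 fun i hi => hπ ⟨_, hB'⟩ ?_).symm
    exact ⟨Or.inr ⟨i, hi, rfl⟩, fun _ => Or.inl rfl⟩
  have hstep (F G) (h : (facGraph (lift p u v ε)).Adj F G) :
      π F = π G ∨ (facGraph p).Adj (π F) (π G) := by
    refine or_iff_not_imp_left.2 fun hne => ⟨hne, ?_⟩
    have h1 := rk_lift_le_trace (apex_mem_inter_iff_or F.2 G.2)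
    have h2 := h.2
    have h3 : rk p (trace v (F.1 ∩ G.1)) ≤ rk p ((π F).1 ∩ (π G).1) := by
      rw [trace_inter]
      exact rk_mono (Set.inter_subset_inter (hπ F) (hπ G))
    simp only [finrank_prod, finrank_self] at h2
    omega
  refine ⟨ε, hA', hB', fun w => ?_⟩
  have hne : (⟨_, hA'⟩ : {F // IsFac (lift p u v ε) F}) ≠ ⟨_, hB'⟩ := by
    intro h
    have : none ∈ some '' A := by
      have h' : some '' A = insert none (some '' B) := congrArg Subtype.val h
      exact h' ▸ Set.mem_insert _ _
    simp at this
  obtain ⟨F, h, t, rfl⟩ := SimpleGraph.Walk.exists_eq_cons_of_ne hne w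
  have hπF : π F = ⟨A, hA⟩ := by
    have := finrank_le_of_raised hAB hu hv hpull hA' F.2
      (fun h' => h.1 (Subtype.ext h')) h.2
    exact Subtype.ext ((π F).2.eq_of_rk hA (Set.inter_subset_right.trans (hπ F))
      Set.inter_subset_left this)
  obtain ⟨w', hw'⟩ := exists_walk_length_le π hstep hπF hπB t
  have := hl w'
  simp only [SimpleGraph.Walk.length_cons]
  omega

end Lift

/-- There is a configuration of rank `D` that is the disjoint union of two facets of sizes `a` and
`b` which are at distance at least `l` in the dual graph. -/
def HasFarBases (D a b l : ℕ) : Prop :=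
  ∃ (E ι : Type) (_ : AddCommGroup E) (_ : Module ℝ E) (_ : FiniteDimensional ℝ E) (_ : Fintype ι)
    (p : ι → E) (A B : Set ι) (hA : IsFac p A) (hB : IsFac p B),
    (∀ i, i ∈ B ↔ i ∉ A) ∧ finrank ℝ E = D ∧ A.ncard = a ∧ B.ncard = b ∧
      ∀ w : (facGraph p).Walk ⟨A, hA⟩ ⟨B, hB⟩, l ≤ w.length

namespace HasFarBases

variable {D a b l : ℕ}

lemma symm (h : HasFarBases D a b l) : HasFarBases D b a l := by
  obtain ⟨E, ι, _, _, _, _, p, A, B, hA, hB, hAB, hD, ha, hb, hl⟩ := h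
  exact ⟨E, ι, _, _, ‹_›, ‹_›, p, B, A, hB, hA, fun i => by rw [hAB, not_not], hD, hb, ha,
    fun w => by simpa using hl w.reverse⟩

lemma le_left (h : HasFarBases D a b l) : D ≤ a + 1 := by
  obtain ⟨E, ι, _, _, _, _, p, A, B, hA, hB, hAB, rfl, rfl, hb, hl⟩ := h
  have := rk_le_ncard (p := p) A
  have := hA.2
  omega

lemma step (hD : 2 ≤ D) (ha : D ≤ a) (h : HasFarBases D a b l) :
    HasFarBases (D + 1) a (b + 1) (l + 1) := by
  have hb := h.symm.le_left
  obtain ⟨E, ι, _, _, _, _, p, A, B, hA, hB, hAB, rfl, rfl, rfl, hl⟩ := h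
  obtain ⟨u, hu, hpu⟩ := exists_mem_span_diff (p := p) (A := A) (by
    have := hA.rk_add_one
    omega)
  obtain ⟨v, hv⟩ : B.Nonempty := by
    rw [← Set.ncard_pos]
    omega
  have hAu : finrank ℝ E ≤ rk p (A \ {u}) + 1 := by
    have h1 := hA.2
    rwa [← Set.insert_eq_of_mem hu, ← Set.insert_sdiff_singleton, rk, span_image_insert,
      sup_eq_left.2 ((Submodule.span_singleton_le_iff_mem _ _).2 hpu)] at h1
  obtain ⟨p', hA', hB', hAu', hpull, hl'⟩ := exists_pull hAB hA hB hu hAu hl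
  obtain ⟨ε, hA'', hB'', hl''⟩ := exists_lift hAB hA' hB' hu hv hAu' hpull hl'
  refine ⟨E × ℝ, Option ι, _, _, inferInstance, inferInstance, _, _, _, hA'', hB'', ?_, ?_, ?_, ?_,
    hl''⟩
  · rintro (_ | i)
    · simp
    · simpa using hAB i
  · simp
  · exact Set.ncard_image_of_injective _ (Option.some_injective _)
  · rw [Set.ncard_insert_of_notMem (by simp),
      Set.ncard_image_of_injective _ (Option.some_injective _)]

theorem balance (s : ℕ) (hD : 2 ≤ D) (hab : a + b = 2 * (D - 1) + s) (h : HasFarBases D a b l) :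
    HasFarBases (D + s) (D + s - 1) (D + s - 1) (l + s) := by
  have ha := h.le_left
  have hb := h.symm.le_left
  induction s generalizing D a b l with
  | zero =>
    obtain rfl : a = D - 1 := by omega
    obtain rfl : b = D - 1 := by omega
    simpa using h
  | succ s ih =>
    have key {a b : ℕ} (h : HasFarBases D a b l) (ha : D ≤ a)
        (hab : a + b = 2 * (D - 1) + (s + 1)) :
        HasFarBases (D + (s + 1)) (D + (s + 1) - 1) (D + (s + 1) - 1) (l + (s + 1)) := by
      have h' := h.step hD ha
      convert ih (by omega) (by omega) h' h'.le_left h'.symm.le_left using 1 <;> omega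
    rcases Nat.lt_or_ge a D with haD | haD
    · exact key h.symm (by omega) (by omega)
    · exact key h haD hab

end HasFarBases

lemma exists_min_ratio {ι : Type*} {F : Set ι} (hfin : F.Finite) {a b : ι → ℝ}
    (ha : ∀ i ∈ F, 0 ≤ a i) (hb : ∃ i ∈ F, b i < 0) :
    ∃ s : ℝ, 0 ≤ s ∧ (∀ i ∈ F, 0 ≤ a i + s * b i) ∧ ∃ i ∈ F, b i < 0 ∧ a i + s * b i = 0 := by
  obtain ⟨w, ⟨hwF, hw⟩, hmin⟩ := Set.exists_min_image {i ∈ F | b i < 0} (fun i => a i / -b i)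
    (hfin.subset (Set.sep_subset _ _)) hb
  refine ⟨a w / -b w, div_nonneg (ha w hwF) (by linarith), fun i hi => ?_, w, hwF, hw, ?_⟩
  · rcases lt_or_ge (b i) 0 with h | h
    · have := hmin i ⟨hi, h⟩
      rw [le_div_iff₀ (by linarith)] at this
      linarith
    · exact add_nonneg (ha i hi) (mul_nonneg (div_nonneg (ha w hwF) (by linarith)) h)
  · have := hw.ne
    rw [div_neg, neg_mul, div_mul_cancel₀ _ this, add_neg_cancel]

lemma eq_of_apply_eq_one {f g : Dual ℝ E} {T : Set ι} (hT : finrank ℝ E ≤ rk p T + 1) {o : E}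
    (hfT : ∀ i ∈ T, f (p i) = 0) (hgT : ∀ i ∈ T, g (p i) = 0) (hf : f o = 1) (hg : g o = 1) :
    f = g := by
  ext x
  have hf0 : f ≠ 0 := by
    rintro rfl
    simp at hf
  have := apply_eq_zero_of_rk hf0 hT hfT hgT (x := x - f x • o) (by simp [hf])
  rw [map_sub, map_smul, hg, smul_eq_mul, mul_one, sub_eq_zero] at this
  exact this.symm

lemma exists_adj_apply_lt [Finite ι] {F : {F // IsFac p F}} {f h₀ : Dual ℝ E} {o y : E}
    (hf : ∀ i, 0 ≤ f (p i)) (hfF : ∀ i, i ∈ F.1 ↔ f (p i) = 0) (hfo : f o = 1)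
    (hy : ∀ h : Dual ℝ E, h y < 0 → ∃ i, h (p i) < 0)
    (hh₀ : h₀ o = 0) (hh₀F : ∀ i ∈ F.1, 0 ≤ h₀ (p i)) (hh₀y : h₀ y < 0) :
    ∃ (F' : {F // IsFac p F}) (f' : Dual ℝ E), (facGraph p).Adj F F' ∧ (∀ i, 0 ≤ f' (p i)) ∧
      (∀ i, i ∈ F'.1 ↔ f' (p i) = 0) ∧ f' o = 1 ∧ f' y < f y := by
  let Z (h : Dual ℝ E) : Set ι := {i ∈ F.1 | h (p i) = 0}
  obtain ⟨m, ⟨h, ⟨hho, hhF, hhy⟩, rfl⟩, hmax⟩ := Set.exists_max_image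
    ((fun h => (Z h).ncard) '' {h : Dual ℝ E | h o = 0 ∧ (∀ i ∈ F.1, 0 ≤ h (p i)) ∧ h y < 0}) id
    ((Set.finite_Iic (Nat.card ι)).subset (by
      rintro _ ⟨h, -, rfl⟩
      exact Set.ncard_le_card _)) ⟨_, h₀, ⟨hh₀, hh₀F, hh₀y⟩, rfl⟩
  have hZ : finrank ℝ E ≤ rk p (Z h) + 2 := by
    by_contra! hlt
    have h1 := finrank_sup_singleton_le (Submodule.span ℝ (p '' Z h)) o
    have h2 := finrank_sup_singleton_le
      (Submodule.span ℝ (p '' Z h) ⊔ Submodule.span ℝ {o}) y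
    obtain ⟨k, hk, hkle⟩ := Submodule.exists_le_ker_of_lt_top
      (Submodule.span ℝ (p '' Z h) ⊔ Submodule.span ℝ {o} ⊔ Submodule.span ℝ {y})
      (Submodule.lt_top_of_finrank_lt_finrank (by rw [rk] at hlt; omega))
    simp only [sup_le_iff, Submodule.span_singleton_le_iff_mem, LinearMap.mem_ker] at hkle
    obtain ⟨⟨hkZ, hko⟩, hky⟩ := hkle
    have hkZ (i) (hi : i ∈ Z h) : k (p i) = 0 := hkZ (Submodule.subset_span ⟨i, hi, rfl⟩)
    obtain ⟨i, hi, hki⟩ : ∃ i ∈ F.1, k (p i) ≠ 0 := by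
      by_contra! hcon
      refine hk ?_
      have := eq_of_apply_eq_one (g := f + k) F.2.2 (fun i hi => (hfF i).1 hi)
        (fun i hi => by simp [(hfF i).1 hi, hcon i hi]) hfo (by simp [hfo, hko])
      simpa using this
    have key (k : Dual ℝ E) (hko : k o = 0) (hky : k y = 0) (hkZ : ∀ i ∈ Z h, k (p i) = 0)
        (hki : k (p i) < 0) : False := by
      obtain ⟨s, -, hs, w, hwF, hw, hsw⟩ := exists_min_ratio (F := F.1) (Set.toFinite _)
        (a := fun i => h (p i)) (b := fun i => k (p i)) hhF ⟨i, hi, hki⟩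
      have hle : (Z (h + s • k)).ncard ≤ (Z h).ncard :=
        hmax _ ⟨h + s • k, ⟨by simp [hho, hko], by simpa using hs, by simpa [hky] using hhy⟩, rfl⟩
      refine hle.not_gt (Set.ncard_lt_ncard ?_ (Set.toFinite _))
      refine Set.ssubset_iff_of_subset ?_ |>.2 ⟨w, ⟨hwF, by simpa using hsw⟩, fun hwZ => ?_⟩
      · exact fun j hj => ⟨hj.1, by simp [hj.2, hkZ j hj]⟩
      · exact hw.ne (hkZ w hwZ)
    rcases hki.lt_or_gt with hki | hki
    · exact key k hko hky hkZ hki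
    · exact key (-k) (by simp [hko]) (by simp [hky]) (fun j hj => by simp [hkZ j hj])
        (by simpa using hki)
  obtain ⟨i, hi⟩ := hy h hhy
  obtain ⟨τ, hτ, hτp, w, -, hw, hτw⟩ := exists_min_ratio (F := Set.univ) (Set.toFinite _)
    (a := fun i => f (p i)) (b := fun i => h (p i)) (fun i _ => hf i) ⟨i, trivial, hi⟩
  have hwF : w ∉ F.1 := fun hwF => (hhF w hwF).not_gt hw
  have hfw : f (p w) ≠ 0 := mt (hfF w).2 hwF
  have hτ0 : 0 < τ := hτ.lt_of_ne' fun h0 => hfw (by simpa [h0] using hτw)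
  have hap (x : E) : (f + τ • h) x = f x + τ * h x := rfl
  have ho : (f + τ • h) o = 1 := by simp [hfo, hho]
  have hZw : p w ∉ Submodule.span ℝ (p '' Z h) := fun hmem =>
    hfw (apply_eq_zero_of_mem_span (fun j hj => (hfF j).1 hj.1) hmem)
  have hsub : insert w (Z h) ⊆ {i | (f + τ • h) (p i) = 0} := by
    rintro j (rfl | hj)
    · exact hτw
    · simp [(hfF j).1 hj.1, hj.2]
  refine ⟨⟨{i | (f + τ • h) (p i) = 0}, ⟨f + τ • h, ?_, fun i => hτp i trivial, fun i => Iff.rfl⟩,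
    ?_⟩, f + τ • h, ⟨fun heq => ?_, ?_⟩, fun i => hτp i trivial, fun i => Iff.rfl, ho, ?_⟩
  · intro h0
    simp [h0] at ho
  · have h1 := rk_insert hZw
    have h2 := rk_mono (p := p) hsub
    omega
  · exact hwF (heq ▸ hsub (Set.mem_insert _ _))
  · refine hZ.trans (Nat.add_le_add_right (rk_mono ?_) 2)
    exact fun j hj => ⟨hj.1, hsub (Or.inr hj)⟩
  · rw [hap]
    nlinarith

/-- The dual graph of the cone over a spanning configuration is connected. -/
theorem reachable [Finite ι] (hp : Submodule.span ℝ (Set.range p) = ⊤) (F B : {F // IsFac p F}) :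
    (facGraph p).Reachable F B := by
  classical
  have := Fintype.ofFinite ι
  set o : E := ∑ i, p i with ho
  have hex (F : {F // IsFac p F}) : ∃ f : Dual ℝ E,
      (∀ i, 0 ≤ f (p i)) ∧ (∀ i, i ∈ F.1 ↔ f (p i) = 0) ∧ f o = 1 := by
    obtain ⟨⟨f, hf, hf0, hfF⟩, -⟩ := F.2
    have hfo : 0 < f o := by
      rw [ho, map_sum]
      refine (Finset.sum_nonneg fun i _ => hf0 i).lt_of_ne' fun h => hf ?_
      rw [Finset.sum_eq_zero_iff_of_nonneg fun i _ => hf0 i] at h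
      refine LinearMap.ext_on hp ?_
      rintro _ ⟨i, rfl⟩
      exact h i (Finset.mem_univ i)
    refine ⟨(f o)⁻¹ • f, fun i => mul_nonneg (by positivity) (hf0 i), fun i => ?_, ?_⟩
    · simp [hfF, hfo.ne']
    · simp [hfo.ne']
  choose f hf hfF hfo using hex
  set y : E := ∑ i with i ∈ B.1, p i with hy
  have hyB (h : Dual ℝ E) : h y = ∑ i with i ∈ B.1, h (p i) := by rw [hy, map_sum]
  obtain ⟨G, hG, hmin⟩ := Set.exists_min_image {G | (facGraph p).Reachable F G} (fun G => f G y)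
    (Set.toFinite _) ⟨F, .refl F⟩
  rcases eq_or_ne G B with rfl | hne
  · exact hG
  have hpos : 0 < f G y := by
    rw [hyB]
    refine (Finset.sum_nonneg fun i _ => hf G i).lt_of_ne' fun h => hne ?_
    rw [Finset.sum_eq_zero_iff_of_nonneg fun i _ => hf G i] at h
    refine (Subtype.ext (B.2.eq_of_subset G.2 fun i hi => ?_)).symm
    exact (hfF G i).2 (h i (by simpa using hi))
  have hBy : f B y = 0 := by
    rw [hyB]
    exact Finset.sum_eq_zero fun i hi => (hfF B i).1 (by simpa using hi)
  obtain ⟨G', f', hadj, hf', hfF', hfo', hlt⟩ := exists_adj_apply_lt (F := G) (h₀ := f B - f G)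
    (hf G) (hfF G) (hfo G) (y := y) (fun h hh => by
      by_contra! hcon
      rw [hyB] at hh
      exact hh.not_ge (Finset.sum_nonneg fun i _ => hcon i)) (by simp [hfo])
    (fun i hi => by simpa [(hfF G i).1 hi] using hf B i) (by simpa [hBy] using hpos)
  have heq : f' = f G' := eq_of_apply_eq_one G'.2.2 (fun i hi => (hfF' i).1 hi)
    (fun i hi => (hfF G' i).1 hi) hfo' (hfo G')
  rw [heq] at hlt
  exact absurd hlt (hmin G' (hG.trans hadj.reachable)).not_gt

section Homogenize

variable {d : ℕ} {x : ι → Esp d}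

/-- The vectors `(x i, 1)`, spanning the cone over the polytope with vertices `x i`. -/
def homogenize (x : ι → Esp d) : ι → Esp d × ℝ := fun i => (x i, 1)

lemma polyDim_empty : polyDim (∅ : Set (Esp d)) = 0 := by
  rw [polyDim, AffineSubspace.span_empty, AffineSubspace.direction_bot, finrank_bot]

lemma finrank_esp_prod (d : ℕ) : finrank ℝ (Esp d × ℝ) = d + 1 := by simp

lemma polyDim_convexHull_image {T : Set ι} (hT : T.Nonempty) :
    polyDim (convexHull ℝ (x '' T)) + 1 = rk (homogenize x) T := by
  obtain ⟨t, ht⟩ := hT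
  have hspan : Submodule.span ℝ (homogenize x '' T) =
      (vectorSpan ℝ (x '' T)).map (LinearMap.inl ℝ (Esp d) ℝ) ⊔
        Submodule.span ℝ {homogenize x t} := by
    rw [vectorSpan_eq_span_vsub_set_right ℝ (Set.mem_image_of_mem x ht), Submodule.map_span]
    refine le_antisymm (Submodule.span_le.2 ?_) (sup_le (Submodule.span_le.2 ?_) ?_)
    · rintro _ ⟨i, hi, rfl⟩
      have : homogenize x i = (x i - x t, 0) + homogenize x t := by simp [homogenize]
      rw [this]
      refine Submodule.add_mem_sup (Submodule.subset_span ?_)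
        (Submodule.mem_span_singleton_self _)
      exact ⟨_, ⟨_, ⟨i, hi, rfl⟩, rfl⟩, rfl⟩
    · rintro _ ⟨_, ⟨_, ⟨i, hi, rfl⟩, rfl⟩, rfl⟩
      have : LinearMap.inl ℝ (Esp d) ℝ (x i -ᵥ x t) = homogenize x i - homogenize x t := by
        simp [homogenize]
      rw [this]
      exact sub_mem (Submodule.subset_span ⟨i, hi, rfl⟩) (Submodule.subset_span ⟨t, ht, rfl⟩)
    · rw [Submodule.span_singleton_le_iff_mem]
      exact Submodule.subset_span ⟨t, ht, rfl⟩
  rw [rk, hspan, finrank_sup_singleton, polyDim, affineSpan_convexHull, direction_affineSpan,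
    ← (Submodule.equivMapOfInjective (LinearMap.inl ℝ (Esp d) ℝ)
      LinearMap.inl_injective _).finrank_eq]
  rintro ⟨z, -, hz⟩
  simpa [homogenize] using congrArg Prod.snd hz

lemma convex_apply_eq_zero (f : Dual ℝ (Esp d × ℝ)) : Convex ℝ {y : Esp d | f (y, 1) = 0} := by
  intro y hy z hz a b _ _ hab
  have : ((a • y + b • z, 1) : Esp d × ℝ) = a • (y, 1) + b • (z, 1) := by simp [hab]
  simp only [Set.mem_ofPred_eq] at *
  rw [this, map_add, map_smul, map_smul, hy, hz, smul_zero, smul_zero, add_zero]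

lemma convex_apply_nonneg (f : Dual ℝ (Esp d × ℝ)) : Convex ℝ {y : Esp d | 0 ≤ f (y, 1)} := by
  intro y hy z hz a b ha hb hab
  have : ((a • y + b • z, 1) : Esp d × ℝ) = a • (y, 1) + b • (z, 1) := by simp [hab]
  simp only [Set.mem_ofPred_eq] at *
  rw [this, map_add, map_smul, map_smul]
  exact add_nonneg (mul_nonneg ha hy) (mul_nonneg hb hz)

lemma apply_nonneg_of_mem {f : Dual ℝ (Esp d × ℝ)} (hf : ∀ i, 0 ≤ f (homogenize x i)) {y : Esp d}
    (hy : y ∈ convexHull ℝ (Set.range x)) : 0 ≤ f (y, 1) := by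
  refine convexHull_min ?_ (convex_apply_nonneg f) hy
  rintro _ ⟨i, rfl⟩
  exact hf i

lemma mem_convexHull_image_iff [Finite ι] {f : Dual ℝ (Esp d × ℝ)}
    (hf : ∀ i, 0 ≤ f (homogenize x i)) {F : Set ι} (hF : ∀ i, i ∈ F ↔ f (homogenize x i) = 0)
    {y : Esp d} :
    y ∈ convexHull ℝ (x '' F) ↔ y ∈ convexHull ℝ (Set.range x) ∧ f (y, 1) = 0 := by
  classical
  have := Fintype.ofFinite ι
  refine ⟨fun hy => ⟨convexHull_mono (Set.image_subset_range x F) hy, ?_⟩, fun ⟨hy, hfy⟩ => ?_⟩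
  · refine convexHull_min ?_ (convex_apply_eq_zero f) hy
    rintro _ ⟨i, hi, rfl⟩
    exact (hF i).1 hi
  · obtain ⟨κ, _, w, z, hw, hw1, hz, rfl⟩ := mem_convexHull_iff_exists_fintype.1 hy
    have hsum : ((∑ k, w k • z k, 1) : Esp d × ℝ) = ∑ k, w k • (z k, 1) := by
      rw [Prod.ext_iff, Prod.fst_sum, Prod.snd_sum]
      simp [hw1]
    have hfz (k : κ) : 0 ≤ f (z k, 1) := apply_nonneg_of_mem hf (subset_convexHull ℝ _ (hz k))
    rw [hsum, map_sum] at hfy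
    simp only [map_smul, smul_eq_mul] at hfy
    rw [Finset.sum_eq_zero_iff_of_nonneg fun k _ => mul_nonneg (hw k) (hfz k)] at hfy
    rw [← Finset.sum_filter_of_ne (p := fun k => w k ≠ 0) fun k _ hk hk0 => hk (by simp [hk0])]
    refine (convex_convexHull ℝ _).sum_mem (fun k _ => hw k) ?_ fun k hk => ?_
    · rw [Finset.sum_filter_ne_zero, hw1]
    · obtain ⟨i, hi⟩ := hz k
      have := (mul_eq_zero.1 (hfy k (Finset.mem_univ k))).resolve_left (Finset.mem_filter.1 hk).2
      rw [← hi] at this ⊢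
      exact subset_convexHull ℝ _ ⟨i, (hF i).2 this, rfl⟩

lemma mem_iff_mem_convexHull [Finite ι] {F : Set ι} (hF : IsFac (homogenize x) F) (i : ι) :
    x i ∈ convexHull ℝ (x '' F) ↔ i ∈ F := by
  obtain ⟨⟨f, -, hf, hfF⟩, -⟩ := hF
  rw [mem_convexHull_image_iff hf hfF, hfF]
  exact and_iff_right (subset_convexHull ℝ _ ⟨i, rfl⟩)

lemma convexHull_image_inter [Finite ι] {F G : Set ι} (hF : IsFac (homogenize x) F)
    (hG : IsFac (homogenize x) G) :
    convexHull ℝ (x '' F) ∩ convexHull ℝ (x '' G) = convexHull ℝ (x '' (F ∩ G)) := by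
  obtain ⟨⟨f, -, hf, hfF⟩, -⟩ := hF
  obtain ⟨⟨g, -, hg, hgG⟩, -⟩ := hG
  ext y
  rw [Set.mem_inter_iff, mem_convexHull_image_iff hf hfF, mem_convexHull_image_iff hg hgG,
    mem_convexHull_image_iff (f := f + g) fun i => add_nonneg (hf i) (hg i)]
  · have (hy : y ∈ convexHull ℝ (Set.range x)) : (f + g) (y, 1) = 0 ↔ f (y, 1) = 0 ∧ g (y, 1) = 0 :=
      add_eq_zero_iff_of_nonneg (apply_nonneg_of_mem hf hy) (apply_nonneg_of_mem hg hy)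
    tauto
  · intro i
    rw [Set.mem_inter_iff, hfF, hgG]
    exact (add_eq_zero_iff_of_nonneg (hf i) (hg i)).symm

lemma IsFac.nonempty (hd : 1 ≤ d) {F : Set ι} (hF : IsFac (homogenize x) F) : F.Nonempty := by
  by_contra h
  have := hF.2
  rw [Set.not_nonempty_iff_eq_empty.1 h, finrank_esp_prod, rk_empty] at this
  omega

lemma IsFac.polyDim_add_one (hd : 1 ≤ d) {F : Set ι} (hF : IsFac (homogenize x) F) :
    polyDim (convexHull ℝ (x '' F)) + 1 = d := by
  have := hF.rk_add_one
  rw [finrank_esp_prod, ← polyDim_convexHull_image (hF.nonempty hd)] at this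
  omega

lemma IsFac.isFacet [Finite ι] (hd : 1 ≤ d) (hP : polyDim (convexHull ℝ (Set.range x)) = d)
    {F : Set ι} (hF : IsFac (homogenize x) F) :
    IsFacet (convexHull ℝ (Set.range x)) (convexHull ℝ (x '' F)) := by
  have hne := hF.nonempty hd
  have hdim := hF.polyDim_add_one hd
  refine ⟨fun _ => ?_, fun h => ?_, (hne.image x).convexHull, hdim.trans hP.symm⟩
  · obtain ⟨⟨f, -, hf, hfF⟩, -⟩ := hF
    obtain ⟨j, hj⟩ := hne
    refine ⟨-(LinearMap.toContinuousLinearMap (f ∘ₗ LinearMap.inl ℝ (Esp d) ℝ)), ?_⟩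
    ext y
    rw [mem_convexHull_image_iff hf hfF]
    have hle (y z : Esp d) : (-(LinearMap.toContinuousLinearMap
        (f ∘ₗ LinearMap.inl ℝ (Esp d) ℝ))) z ≤ (-(LinearMap.toContinuousLinearMap
        (f ∘ₗ LinearMap.inl ℝ (Esp d) ℝ))) y ↔ f (y, 1) ≤ f (z, 1) := by
      rw [apply_prod f y, apply_prod f z]
      simp
    simp only [Set.mem_ofPred_eq, hle]
    refine and_congr_right fun hy => ⟨fun h z hz => h ▸ apply_nonneg_of_mem hf hz, fun h => ?_⟩
    exact le_antisymm ((h _ (subset_convexHull ℝ _ ⟨j, rfl⟩)).trans_eq ((hfF j).1 hj))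
      (apply_nonneg_of_mem hf hy)
  · rw [h] at hdim
    omega

lemma isFac_of_isFacet [Finite ι] (hP : polyDim (convexHull ℝ (Set.range x)) = d)
    {G : Set (Esp d)} (hG : IsFacet (convexHull ℝ (Set.range x)) G) :
    IsFac (homogenize x) {i | x i ∈ G} ∧ convexHull ℝ (x '' {i | x i ∈ G}) = G := by
  obtain ⟨hexp, hne, ⟨y₀, hy₀⟩, hdim⟩ := hG
  obtain ⟨φ, hφ⟩ := hexp ⟨y₀, hy₀⟩
  have hGmem (y : Esp d) : y ∈ G ↔ y ∈ convexHull ℝ (Set.range x) ∧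
      ∀ z ∈ convexHull ℝ (Set.range x), φ z ≤ φ y := by
    rw [hφ]
    rfl
  have hy₀' := (hGmem y₀).1 hy₀
  let f : Dual ℝ (Esp d × ℝ) := φ y₀ • LinearMap.snd ℝ (Esp d) ℝ -
    φ.toLinearMap ∘ₗ LinearMap.fst ℝ (Esp d) ℝ
  have hfap (y : Esp d) : f (y, 1) = φ y₀ - φ y := by simp [f]
  have hfG {y : Esp d} (hy : y ∈ convexHull ℝ (Set.range x)) : y ∈ G ↔ f (y, 1) = 0 := by
    rw [hGmem, hfap, sub_eq_zero]
    refine ⟨fun h => le_antisymm (h.2 _ hy₀'.1) (hy₀'.2 _ hy), fun h => ⟨hy, ?_⟩⟩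
    rw [← h]
    exact hy₀'.2
  have hf (i : ι) : 0 ≤ f (homogenize x i) := by
    rw [homogenize, hfap, sub_nonneg]
    exact hy₀'.2 _ (subset_convexHull ℝ _ ⟨i, rfl⟩)
  have hfF (i : ι) : i ∈ {i | x i ∈ G} ↔ f (homogenize x i) = 0 :=
    hfG (subset_convexHull ℝ _ ⟨i, rfl⟩)
  have hconv : convexHull ℝ (x '' {i | x i ∈ G}) = G := by
    ext y
    rw [mem_convexHull_image_iff hf hfF]
    exact ⟨fun h => (hfG h.1).2 h.2, fun h => ⟨((hGmem y).1 h).1, (hfG ((hGmem y).1 h).1).1 h⟩⟩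
  refine ⟨⟨⟨f, ?_, hf, hfF⟩, ?_⟩, hconv⟩
  · rintro h0
    refine hne (Set.Subset.antisymm (fun y hy => ((hGmem y).1 hy).1) fun y hy => ?_)
    rw [hfG hy, h0]
    rfl
  · have hne' : {i | x i ∈ G}.Nonempty := by
      rw [← Set.image_nonempty (f := x), ← convexHull_nonempty_iff (𝕜 := ℝ), hconv]
      exact ⟨y₀, hy₀⟩
    rw [← polyDim_convexHull_image hne', hconv, hdim, hP, finrank_esp_prod]

/-- The dual graph of a polytope is that of the cone over it. -/
def facGraphIso [Finite ι] (hd : 3 ≤ d) (hP : polyDim (convexHull ℝ (Set.range x)) = d) :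
    facGraph (homogenize x) ≃g dualGraph (convexHull ℝ (Set.range x)) where
  toFun F := ⟨convexHull ℝ (x '' F.1), F.2.isFacet (by omega) hP⟩
  invFun G := ⟨{i | x i ∈ G.1}, (isFac_of_isFacet hP G.2).1⟩
  left_inv F := Subtype.ext (Set.ext fun i => mem_iff_mem_convexHull F.2 i)
  right_inv G := Subtype.ext (isFac_of_isFacet hP G.2).2
  map_rel_iff' := by
    intro F G
    have hinj : convexHull ℝ (x '' F.1) = convexHull ℝ (x '' G.1) ↔ F = G := by
      refine ⟨fun h => Subtype.ext (Set.ext fun i => ?_), fun h => by rw [h]⟩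
      rw [← mem_iff_mem_convexHull F.2, h, mem_iff_mem_convexHull G.2]
    have hdim : F ≠ G → (polyDim (convexHull ℝ (x '' (F.1 ∩ G.1))) + 2 = d ↔
        d + 1 ≤ rk (homogenize x) (F.1 ∩ G.1) + 2) := by
      intro hne
      have hlt : rk (homogenize x) (F.1 ∩ G.1) + 1 < d + 1 := by
        by_contra! hcon
        rw [← finrank_esp_prod] at hcon
        exact hne (Subtype.ext (F.2.eq_of_rk G.2 Set.inter_subset_left Set.inter_subset_right
          hcon))
      rcases (F.1 ∩ G.1).eq_empty_or_nonempty with h | h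
      · rw [h, rk_empty, Set.image_empty, convexHull_empty, polyDim_empty]
        omega
      · have := polyDim_convexHull_image (x := x) h
        omega
    rw [dualGraph, SimpleGraph.fromRel_adj]
    simp only [Equiv.coe_fn_mk, ne_eq, Subtype.mk.injEq, hinj, facGraph, finrank_esp_prod, hP]
    rw [Set.inter_comm (convexHull ℝ (x '' G.1)), or_self, convexHull_image_inter F.2 G.2]
    exact and_congr_right hdim

end Homogenize

lemma rk_smul_map_le {E' : Type*} [AddCommGroup E'] [Module ℝ E'] [FiniteDimensional ℝ E']
    (Ψ : E →ₗ[ℝ] E') (c : ι → ℝ) (T : Set ι) : rk (fun i => c i • Ψ (p i)) T ≤ rk p T := by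
  refine le_trans (Submodule.finrank_mono ?_) (Submodule.finrank_map_le Ψ _)
  rw [Submodule.span_le]
  rintro _ ⟨i, hi, rfl⟩
  exact Submodule.smul_mem _ _ (Submodule.mem_map_of_mem (Submodule.subset_span ⟨i, hi, rfl⟩))

lemma rk_smul_map {E' : Type*} [AddCommGroup E'] [Module ℝ E'] [FiniteDimensional ℝ E']
    (Ψ : E ≃ₗ[ℝ] E') {c : ι → ℝ} (hc : ∀ i, 0 < c i) (T : Set ι) :
    rk (fun i => c i • Ψ (p i)) T = rk p T := by
  refine le_antisymm (rk_smul_map_le Ψ.toLinearMap c T) ?_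
  have h := rk_smul_map_le (p := fun i => c i • Ψ (p i)) Ψ.symm.toLinearMap (fun i => (c i)⁻¹) T
  rwa [← rk_congr (p := p) fun i _ => by simp [smul_smul, (hc i).ne']] at h

lemma isFac_smul_map_iff {E' : Type*} [AddCommGroup E'] [Module ℝ E'] [FiniteDimensional ℝ E']
    (Ψ : E ≃ₗ[ℝ] E') {c : ι → ℝ} (hc : ∀ i, 0 < c i) {F : Set ι} :
    IsFac (fun i => c i • Ψ (p i)) F ↔ IsFac p F := by
  rw [IsFac, IsFac, rk_smul_map Ψ hc, Ψ.finrank_eq]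
  refine and_congr_left fun _ => ⟨?_, ?_⟩
  · rintro ⟨f, hf, hf0, hfF⟩
    refine ⟨f ∘ₗ Ψ.toLinearMap, fun h => hf ?_, fun i => ?_, fun i => ?_⟩
    · ext y
      simpa using LinearMap.congr_fun h (Ψ.symm y)
    · simpa [hc i] using hf0 i
    · simpa [(hc i).ne'] using hfF i
  · rintro ⟨f, hf, hf0, hfF⟩
    refine ⟨f ∘ₗ Ψ.symm.toLinearMap, fun h => hf ?_, fun i => ?_, fun i => ?_⟩
    · ext y
      simpa using LinearMap.congr_fun h (Ψ y)
    · simpa [hc i] using hf0 i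
    · simpa [(hc i).ne'] using hfF i

lemma exists_linearEquiv_snd {k : ℕ} (hE : finrank ℝ E = k + 1) {f : Dual ℝ E} (hf : f ≠ 0) :
    ∃ Ψ : E ≃ₗ[ℝ] Esp k × ℝ, ∀ y, (Ψ y).2 = f y := by
  have hker : finrank ℝ (LinearMap.ker f) = finrank ℝ (Esp k) := by
    have := Module.Dual.finrank_ker_add_one_of_ne_zero hf
    rw [finrank_euclideanSpace, Fintype.card_fin]
    omega
  obtain ⟨π, hπ⟩ := LinearMap.exists_extend (LinearEquiv.ofFinrankEq _ _ hker).toLinearMap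
  refine ⟨LinearEquiv.ofInjectiveOfFinrankEq (π.prod f) ?_ (by rw [hE, finrank_esp_prod]),
    fun y => rfl⟩
  rw [injective_iff_map_eq_zero]
  intro y hy
  obtain ⟨h1, h2⟩ := Prod.ext_iff.1 hy
  have h3 : (LinearEquiv.ofFinrankEq _ _ hker) ⟨y, h2⟩ = 0 :=
    (LinearMap.congr_fun hπ ⟨y, h2⟩).symm.trans h1
  exact congrArg Subtype.val ((LinearEquiv.map_eq_zero_iff _).1 h3)

/-- A configuration covered by two disjoint facets is, up to rescaling, the homogenization of a
point configuration for which the two facets are parallel. -/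
lemma exists_homogenize {k : ℕ} (hE : finrank ℝ E = k + 1) (hk : 1 ≤ k) {A B : Set ι}
    (hAB : ∀ i, i ∈ B ↔ i ∉ A) (hA : IsFac p A) (hB : IsFac p B) {l : ℕ}
    (hl : ∀ w : (facGraph p).Walk ⟨A, hA⟩ ⟨B, hB⟩, l ≤ w.length) :
    ∃ (x : ι → Esp k) (hA' : IsFac (homogenize x) A) (hB' : IsFac (homogenize x) B),
      (∀ w : (facGraph (homogenize x)).Walk ⟨A, hA'⟩ ⟨B, hB'⟩, l ≤ w.length) ∧
      ∃ f g : Dual ℝ (Esp k × ℝ), f + g = LinearMap.snd ℝ (Esp k) ℝ ∧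
        (∀ i, 0 ≤ f (homogenize x i)) ∧ (∀ i, i ∈ A ↔ f (homogenize x i) = 0) ∧
        (∀ i, 0 ≤ g (homogenize x i)) ∧ (∀ i, i ∈ B ↔ g (homogenize x i) = 0) := by
  obtain ⟨⟨f, hf, hf0, hfA⟩, -⟩ := id hA
  obtain ⟨⟨g, hg, hg0, hgB⟩, -⟩ := id hB
  have hpos (i : ι) : 0 < (f + g) (p i) := by
    refine (add_nonneg (hf0 i) (hg0 i)).lt_of_ne' fun h => ?_
    obtain ⟨h1, h2⟩ := (add_eq_zero_iff_of_nonneg (hf0 i) (hg0 i)).1 h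
    exact (hAB i).1 ((hgB i).2 h2) ((hfA i).2 h1)
  have hfg : f + g ≠ 0 := by
    intro h
    obtain ⟨i, -⟩ : A.Nonempty := by
      by_contra hcon
      have := hA.2
      rw [Set.not_nonempty_iff_eq_empty.1 hcon, rk_empty] at this
      omega
    simpa [h] using hpos i
  obtain ⟨Ψ, hΨ⟩ := exists_linearEquiv_snd hE hfg
  let c (i : ι) : ℝ := ((f + g) (p i))⁻¹
  have hc (i : ι) : 0 < c i := inv_pos.2 (hpos i)
  let x (i : ι) : Esp k := c i • (Ψ (p i)).1
  have hx : homogenize x = fun i => c i • Ψ (p i) := by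
    ext1 i
    refine Prod.ext rfl ?_
    change 1 = c i * (Ψ (p i)).2
    rw [hΨ, inv_mul_cancel₀ (hpos i).ne']
  have hfac {F : Set ι} : IsFac (homogenize x) F ↔ IsFac p F := hx ▸ isFac_smul_map_iff Ψ hc
  have hrk (T : Set ι) : rk (homogenize x) T = rk p T := hx ▸ rk_smul_map Ψ hc T
  refine ⟨x, hfac.2 hA, hfac.2 hB, fun w => ?_, f ∘ₗ Ψ.symm.toLinearMap, g ∘ₗ Ψ.symm.toLinearMap,
    ?_, fun i => ?_, fun i => ?_, fun i => ?_, fun i => ?_⟩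
  · obtain ⟨w', hw'⟩ := exists_walk_length_le (H := facGraph p)
      (fun F : {F // IsFac (homogenize x) F} => (⟨F.1, hfac.1 F.2⟩ : {F // IsFac p F}))
      (fun F G (h : (facGraph (homogenize x)).Adj F G) => Or.inr
        ⟨fun h' => h.1 (Subtype.ext (Subtype.mk.inj h')), by
        rw [hE, ← finrank_esp_prod, ← hrk]
        exact h.2⟩) rfl rfl w
    exact (hl w').trans hw'
  · refine LinearMap.ext fun y => ?_
    rw [← LinearMap.add_comp]
    exact (hΨ (Ψ.symm y)).symm.trans (by simp)
  · simpa [hx, hc i] using hf0 i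
  · simpa [hx, (hc i).ne'] using hfA i
  · simpa [hx, hc i] using hg0 i
  · simpa [hx, (hc i).ne'] using hgB i

lemma span_range_eq_top {A B : Set ι} (hAB : ∀ i, i ∈ B ↔ i ∉ A) (hA : IsFac p A)
    (hB : B.Nonempty) : Submodule.span ℝ (Set.range p) = ⊤ := by
  obtain ⟨⟨f, -, -, hfA⟩, hr⟩ := hA
  obtain ⟨j, hj⟩ := hB
  have h1 : rk p (insert j A) = rk p A + 1 := rk_insert fun hmem => (hAB j).1 hj ((hfA j).2
    (apply_eq_zero_of_mem_span (fun i hi => (hfA i).1 hi) hmem))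
  have h2 := rk_mono (p := p) (Set.subset_univ (insert j A))
  refine Submodule.eq_top_of_finrank_eq (le_antisymm (Submodule.finrank_le _) ?_)
  rw [← Set.image_univ]
  rw [rk, rk] at *
  omega

section Polytope

variable {d : ℕ} {x : ι → Esp d}

lemma direction_affineSpan_le {f : Dual ℝ (Esp d × ℝ)} {A : Set ι}
    (hA : ∀ i ∈ A, f (homogenize x i) = 0) :
    (affineSpan ℝ (convexHull ℝ (x '' A))).direction ≤
      LinearMap.ker (f ∘ₗ LinearMap.inl ℝ (Esp d) ℝ) := by
  rw [affineSpan_convexHull, direction_affineSpan, vectorSpan, Submodule.span_le]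
  rintro _ ⟨_, ⟨i, hi, rfl⟩, _, ⟨j, hj, rfl⟩, rfl⟩
  have : LinearMap.inl ℝ (Esp d) ℝ (x i -ᵥ x j) = homogenize x i - homogenize x j := by
    simp [homogenize]
  change f (LinearMap.inl ℝ (Esp d) ℝ (x i -ᵥ x j)) = 0
  rw [this, map_sub, hA i hi, hA j hj, sub_zero]

lemma IsFac.direction_eq_ker (hd : 1 ≤ d) {A : Set ι} (hA : IsFac (homogenize x) A)
    {f : Dual ℝ (Esp d × ℝ)} (hf : f ∘ₗ LinearMap.inl ℝ (Esp d) ℝ ≠ 0)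
    (hfA : ∀ i ∈ A, f (homogenize x i) = 0) :
    (affineSpan ℝ (convexHull ℝ (x '' A))).direction =
      LinearMap.ker (f ∘ₗ LinearMap.inl ℝ (Esp d) ℝ) := by
  refine Submodule.eq_of_le_of_finrank_le (direction_affineSpan_le hfA) ?_
  have h1 := Module.Dual.finrank_ker_add_one_of_ne_zero hf
  have h2 := hA.polyDim_add_one hd
  rw [finrank_euclideanSpace, Fintype.card_fin] at h1
  rw [polyDim] at h2
  omega

lemma mem_extremePoints_of_exists [Finite ι] {i : ι} (h : ∃ f : Dual ℝ (Esp d × ℝ),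
    (∀ j, 0 ≤ f (homogenize x j)) ∧ ∀ j, j ∈ ({i} : Set ι) ↔ f (homogenize x j) = 0) :
    x i ∈ Set.extremePoints ℝ (convexHull ℝ (Set.range x)) := by
  obtain ⟨f, hf, hfi⟩ := h
  have hzero {y : Esp d} (hy : y ∈ convexHull ℝ (Set.range x)) (h0 : f (y, 1) = 0) : y = x i := by
    simpa using (mem_convexHull_image_iff hf hfi).2 ⟨hy, h0⟩
  refine mem_extremePoints.2 ⟨subset_convexHull ℝ _ ⟨i, rfl⟩, fun y hy z hz hseg => ?_⟩
  obtain ⟨a, b, ha, hb, hab, hi⟩ := hseg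
  have h0 : f (x i, 1) = 0 := (hfi i).1 rfl
  have hsum : ((x i, 1) : Esp d × ℝ) = a • (y, 1) + b • (z, 1) := by
    rw [← hi]
    simp [hab]
  have hy0 := apply_nonneg_of_mem hf hy
  have hz0 := apply_nonneg_of_mem hf hz
  rw [hsum, map_add, map_smul, map_smul, smul_eq_mul, smul_eq_mul,
    add_eq_zero_iff_of_nonneg (mul_nonneg ha.le hy0) (mul_nonneg hb.le hz0)] at h0
  exact ⟨hzero hy ((mul_eq_zero.1 h0.1).resolve_left ha.ne'),
    hzero hz ((mul_eq_zero.1 h0.2).resolve_left hb.ne')⟩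

end Polytope

/-- A configuration of rank `k + 1` that is the union of two simplicial facets gives a prismatoid of
dimension `k` with simplices as bases. -/
theorem HasFarBases.exists_prismatoid {k l : ℕ} (hk : 3 ≤ k) (h : HasFarBases (k + 1) k k l) :
    ∃ Q : Prismatoid k, Q.nverts = 2 * k ∧ l ≤ Q.width := by
  obtain ⟨E, ι, _, _, _, _, p, A, B, hA₀, hB₀, hAB, hD, ha, hb, hl₀⟩ := h
  obtain ⟨x, hA, hB, hl, f, g, hfg, hf, hfA, hg, hgB⟩ :=
    exists_homogenize hD (by omega) hAB hA₀ hB₀ hl₀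
  have hd : 1 ≤ k := by omega
  have hspan := span_range_eq_top hAB hA (hB.nonempty hd)
  have hex (i : ι) : ∃ f : Dual ℝ (Esp k × ℝ),
      (∀ j, 0 ≤ f (homogenize x j)) ∧ ∀ j, j ∈ ({i} : Set ι) ↔ f (homogenize x j) = 0 := by
    have h1 := hA.rk_add_one
    have h2 := hB.rk_add_one
    rw [finrank_esp_prod] at h1 h2
    by_cases hi : i ∈ A
    · exact exists_apply_eq_zero_iff hA (linearIndepOn_of_ncard_le (by omega)) hi
    · exact exists_apply_eq_zero_iff hB (linearIndepOn_of_ncard_le (by omega)) ((hAB i).2 hi)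
  have hinj : Function.Injective x := by
    intro i j hij
    obtain ⟨f, -, hfi⟩ := hex i
    refine ((hfi j).2 ?_).symm
    rw [homogenize, ← hij]
    exact (hfi i).1 rfl
  have hext : Set.extremePoints ℝ (convexHull ℝ (Set.range x)) = Set.range x := by
    refine extremePoints_convexHull_subset.antisymm ?_
    rintro _ ⟨i, rfl⟩
    exact mem_extremePoints_of_exists (hex i)
  have hdim : polyDim (convexHull ℝ (Set.range x)) = k := by
    obtain ⟨i, -⟩ := hA.nonempty hd
    have := polyDim_convexHull_image (x := x) (T := Set.univ) ⟨i, trivial⟩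
    rw [rk, Set.image_univ, Set.image_univ, hspan, finrank_top, finrank_esp_prod] at this
    omega
  have hfl : f ∘ₗ LinearMap.inl ℝ (Esp k) ℝ ≠ 0 := by
    intro h0
    have h1 (y : Esp k) : f (y, 0) = 0 := LinearMap.congr_fun h0 y
    obtain ⟨i, hi⟩ := hA.nonempty hd
    obtain ⟨j, hj⟩ := hB.nonempty hd
    have h2 := (hfA i).1 hi
    rw [homogenize, apply_prod, h1] at h2
    refine (hAB j).1 hj ((hfA j).2 ?_)
    rw [homogenize, apply_prod, h1, h2]
  have hgl : g ∘ₗ LinearMap.inl ℝ (Esp k) ℝ = -(f ∘ₗ LinearMap.inl ℝ (Esp k) ℝ) := by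
    rw [eq_neg_iff_add_eq_zero, add_comm, ← LinearMap.add_comp, hfg]
    ext
    simp
  let Q : Prismatoid k :=
    { P := convexHull ℝ (Set.range x)
      Qp := convexHull ℝ (x '' A)
      Qm := convexHull ℝ (x '' B)
      poly := ⟨(Set.finite_range x).toFinset, by simp⟩
      dimP := hdim
      facetP := hA.isFacet hd hdim
      facetM := hB.isFacet hd hdim
      ne := by
        obtain ⟨j, hj⟩ := hB.nonempty hd
        intro h
        refine (hAB j).1 hj ((mem_iff_mem_convexHull hA j).1 ?_)
        rw [h]
        exact (mem_iff_mem_convexHull hB j).2 hj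
      parallel := by
        rw [hA.direction_eq_ker hd hfl fun i hi => (hfA i).1 hi,
          hB.direction_eq_ker hd (by rwa [hgl, neg_ne_zero]) fun i hi => (hgB i).1 hi, hgl]
        ext
        simp
      cover := by
        rw [hext]
        rintro _ ⟨i, rfl⟩
        by_cases hi : i ∈ A
        · exact Or.inl (subset_convexHull ℝ _ ⟨i, hi, rfl⟩)
        · exact Or.inr (subset_convexHull ℝ _ ⟨i, (hAB i).2 hi, rfl⟩) }
  refine ⟨Q, ?_, ?_⟩
  · have hBA : B = Aᶜ := Set.ext hAB
    rw [Prismatoid.nverts, hext, ← Set.image_univ, Set.ncard_image_of_injective _ hinj,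
      Set.ncard_univ, ← Set.ncard_add_ncard_compl A, ← hBA, ha, hb]
    omega
  · let e := facGraphIso (x := x) hk hdim
    have hr : (dualGraph Q.P).Reachable ⟨Q.Qp, Q.facetP⟩ ⟨Q.Qm, Q.facetM⟩ :=
      (reachable hspan ⟨A, hA⟩ ⟨B, hB⟩).map e.toHom
    obtain ⟨w, hw⟩ := hr.exists_walk_length_eq_dist
    obtain ⟨w', hw'⟩ := exists_walk_length_le e.symm (fun F G h => Or.inr (e.symm.map_adj_iff.2 h))
      (e.symm_apply_apply ⟨A, hA⟩) (e.symm_apply_apply ⟨B, hB⟩) w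
    exact (hl w').trans (hw'.trans hw.le)

/-- Two parallel faces that meet coincide. -/
lemma subset_of_direction_eq {d : ℕ} {P F G : Set (Esp d)} (hF : IsExposed ℝ P F) (hGP : G ⊆ P)
    (hFG : (affineSpan ℝ F).direction = (affineSpan ℝ G).direction) {y : Esp d} (hyF : y ∈ F)
    (hyG : y ∈ G) : G ⊆ F := by
  obtain ⟨φ, hφ⟩ := hF ⟨y, hyF⟩
  have hmem (z : Esp d) : z ∈ F ↔ z ∈ P ∧ ∀ w ∈ P, φ w ≤ φ z := by
    rw [hφ]
    rfl
  have hle : (affineSpan ℝ F).direction ≤ LinearMap.ker φ.toLinearMap := by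
    rw [direction_affineSpan, vectorSpan, Submodule.span_le]
    rintro _ ⟨a, ha, b, hb, rfl⟩
    have h1 := ((hmem a).1 ha).2 b ((hmem b).1 hb).1
    have h2 := ((hmem b).1 hb).2 a ((hmem a).1 ha).1
    simpa [sub_eq_zero] using le_antisymm h2 h1
  intro z hz
  have h1 : z -ᵥ y ∈ (affineSpan ℝ G).direction :=
    AffineSubspace.vsub_mem_direction (subset_affineSpan ℝ G hz) (subset_affineSpan ℝ G hyG)
  have h2 : φ (z -ᵥ y) = 0 := hle (by rwa [hFG])
  rw [vsub_eq_sub, map_sub, sub_eq_zero] at h2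
  rw [hmem, h2]
  exact ⟨hGP hz, ((hmem y).1 hyF).2⟩

lemma disjoint_bases {d : ℕ} (Q : Prismatoid d) : Disjoint Q.Qp Q.Qm := by
  rw [Set.disjoint_left]
  intro y hp hm
  refine Q.ne (Set.Subset.antisymm ?_ ?_)
  · exact subset_of_direction_eq Q.facetM.1 Q.facetP.1.subset Q.parallel.symm hm hp
  · exact subset_of_direction_eq Q.facetP.1 Q.facetM.1.subset Q.parallel hp hm

lemma three_le_of_lt_width {d : ℕ} (Q : Prismatoid d) (h : d < Q.width) : 3 ≤ d := by
  have hne : (⟨Q.Qp, Q.facetP⟩ : {F // IsFacet Q.P F}) ≠ ⟨Q.Qm, Q.facetM⟩ :=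
    fun h => Q.ne (congrArg Subtype.val h)
  obtain ⟨w⟩ := SimpleGraph.Reachable.of_dist_ne_zero (Nat.ne_zero_of_lt h)
  obtain ⟨F, hadj, -⟩ := SimpleGraph.Walk.exists_eq_cons_of_ne hne w
  have h2 : 2 ≤ d := by
    have := (SimpleGraph.fromRel_adj _ _ _).1 hadj
    rw [Q.dimP] at this
    omega
  by_contra! h3
  obtain rfl : d = 2 := by omega
  have hadj' : (dualGraph Q.P).Adj ⟨Q.Qp, Q.facetP⟩ ⟨Q.Qm, Q.facetM⟩ := by
    refine (SimpleGraph.fromRel_adj _ _ _).2 ⟨hne, Or.inl ?_⟩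
    rw [Q.dimP, (disjoint_bases Q).inter_eq, polyDim_empty]
  have := SimpleGraph.dist_eq_one_iff_adj.2 hadj'
  rw [Prismatoid.width, this] at h
  omega

lemma exists_vertices {d : ℕ} {P : Set (Esp d)} (hP : IsPolytope P) :
    ∃ (ι : Type) (_ : Finite ι) (x : ι → Esp d), Function.Injective x ∧
      Set.range x = Set.extremePoints ℝ P ∧ P = convexHull ℝ (Set.range x) := by
  obtain ⟨S, hS⟩ := hP
  have hfin : (Set.extremePoints ℝ P).Finite := by
    rw [hS]
    exact S.finite_toSet.subset extremePoints_convexHull_subset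
  refine ⟨Set.extremePoints ℝ P, hfin.to_subtype, Subtype.val, Subtype.val_injective,
    Subtype.range_val, ?_⟩
  have hc : IsCompact P := hS ▸ S.finite_toSet.isCompact_convexHull ℝ
  have hconv : Convex ℝ P := hS ▸ convex_convexHull ℝ _
  rw [Subtype.range_val, ← (hfin.isClosed_convexHull ℝ).closure_eq,
    closure_convexHull_extremePoints hc hconv]

theorem exists_hasFarBases {d : ℕ} (Q : Prismatoid d) (hd : 3 ≤ d) :
    ∃ a b, a + b = Q.nverts ∧ HasFarBases (d + 1) a b Q.width := by
  obtain ⟨ι, hι, x, hinj, hrange, hP⟩ := exists_vertices Q.poly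
  have hdisj := disjoint_bases Q
  obtain ⟨P, Qp, Qm, poly, dimP, facetP, facetM, ne, parallel, cover⟩ := Q
  dsimp only at hrange hP hdisj
  subst hP
  have hAB (i : ι) : i ∈ {i | x i ∈ Qm} ↔ i ∉ {i | x i ∈ Qp} := by
    have h1 := cover (hrange ▸ Set.mem_range_self i)
    exact ⟨fun h h' => Set.disjoint_left.1 hdisj h' h, fun h => h1.resolve_left h⟩
  have hA := isFac_of_isFacet dimP facetP
  have hB := isFac_of_isFacet dimP facetM
  have := Fintype.ofFinite ι
  refine ⟨{i | x i ∈ Qp}.ncard, {i | x i ∈ Qm}.ncard, ?_, Esp d × ℝ, ι, _, _, inferInstance, this,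
    homogenize x, _, _, hA.1, hB.1, hAB, finrank_esp_prod d, rfl, rfl, fun w => ?_⟩
  · have hBA : {i | x i ∈ Qm} = {i | x i ∈ Qp}ᶜ := Set.ext hAB
    rw [Prismatoid.nverts, ← hrange, ← Set.image_univ, Set.ncard_image_of_injective _ hinj,
      Set.ncard_univ, hBA, Set.ncard_add_ncard_compl]
  · let e := facGraphIso (x := x) hd dimP
    have hA' : e ⟨_, hA.1⟩ = ⟨Qp, facetP⟩ := Subtype.ext hA.2
    have hB' : e ⟨_, hB.1⟩ = ⟨Qm, facetM⟩ := Subtype.ext hB.2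
    obtain ⟨w', hw'⟩ := exists_walk_length_le e (fun F G h => Or.inr (e.map_adj_iff.2 h)) hA' hB' w
    exact (SimpleGraph.dist_le w').trans hw'

end VectorConfig

/-- If `Q` is a `d`-prismatoid with `n` vertices and width `l > d`, then there
is a prismatoid `Q'` of dimension `n - d` with `2n - 2d` vertices and width at
least `l + n - 2d`; in particular `Q'` violates the dual Hirsch conjecture:
its width exceeds (number of vertices) − (dimension). -/
theorem stmt10 (d n l : ℕ) (Q : Prismatoid d) (hn : Q.nverts = n) (hl : Q.width = l)
    (h : d < l) :
    ∃ Q' : Prismatoid (n - d), Q'.nverts = 2 * n - 2 * d ∧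
      l + n - 2 * d ≤ Q'.width ∧ Q'.nverts - (n - d) < Q'.width := by
  subst hn hl
  have hd := VectorConfig.three_le_of_lt_width Q h
  obtain ⟨a, b, hab, hfar⟩ := VectorConfig.exists_hasFarBases Q hd
  have ha := hfar.le_left
  have hb := hfar.symm.le_left
  have hfar' := hfar.balance (s := Q.nverts - 2 * d) (by omega) (by omega)
  have h1 : d + 1 + (Q.nverts - 2 * d) = Q.nverts - d + 1 := by omega
  rw [h1, Nat.add_sub_cancel] at hfar'
  obtain ⟨Q', hn', hl'⟩ := hfar'.exists_prismatoid (by omega)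
  exact ⟨Q', by omega, by omega, by omega⟩
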